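/- arXiv:1207.2368 — 5 statements merged into one kernel-verified Lean document; each statement's English description precedes it below -/
import Mathlib

section
/- For all integers n and d with 1 ≤ d ≤ n, T(2n,d) = Σ_{j=0}^{⌊(d-1)/2⌋} ((-1)^j π^{2j} / (2^{2d-2} (2j)! d)) · C(2d-2j-2, d-1) · t(2n-2j), where C(a,b) denotes the binomial coefficient and t(2m) = Σ_{k≥1} 1/(2k-1)^{2m} is the depth-one multiple t-value. -/
open scoped BigOperators

/-- Depth-one multiple t-value: `t1 m = t(2m) = ∑_{k ≥ 1} 1/(2k-1)^{2m}`. -/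
noncomputable def t1 (m : ℕ) : ℝ := ∑' k : ℕ, 1 / (2 * (k : ℝ) + 1) ^ (2 * m)

/-- Multiple t-value `t(s₀, …, s_{d-1})`, summed over `n₀ > n₁ > ⋯ > n_{d-1} ≥ 1`
(encoded via `f i = n_i - 1`, so the odd number `2 n_i - 1` is `2 (f i) + 1`). -/
noncomputable def mtv (d : ℕ) (s : Fin d → ℕ) : ℝ :=
  ∑' f : {f : Fin d → ℕ // StrictAnti f}, ∏ i, 1 / (2 * (f.1 i : ℝ) + 1) ^ (s i)

/-- `Tsum n d = T(2n, d)`: the sum of all multiple t-values of weight `2n` and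
depth `d` with all arguments even. -/
noncomputable def Tsum (n d : ℕ) : ℝ :=
  ∑ j ∈ (Finset.Nat.antidiagonalTuple d n).filter (fun j => ∀ i, 1 ≤ j i),
    mtv d (fun i => 2 * j i)

section FiniteIdentities

variable {ι A : Type*} [CommRing A]

/-- The elementary symmetric function of degree `m` in the values of `a` on `s`. -/
def elemSym (s : Finset ι) (a : ι → A) (m : ℕ) : A :=
  ∑ t ∈ s.powersetCard m, ∏ i ∈ t, a i

theorem elemSym_eq_zero_of_card_lt (s : Finset ι) (a : ι → A) {m : ℕ} (h : s.card < m) :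
    elemSym s a m = 0 := by
  simp [elemSym, Finset.powersetCard_eq_empty.2 h]

theorem elemSym_zero (s : Finset ι) (a : ι → A) : elemSym s a 0 = 1 := by
  simp [elemSym]

theorem elemSym_one (s : Finset ι) (a : ι → A) : elemSym s a 1 = ∑ i ∈ s, a i := by
  simp [elemSym, Finset.powersetCard_one]

theorem prod_one_add_mul_eq_sum_elemSym (s : Finset ι) (a : ι → A) (c : A) :
    ∏ i ∈ s, (1 + c * a i) = ∑ m ∈ Finset.range (s.card + 1), c ^ m * elemSym s a m := by
  classical
  rw [Finset.prod_one_add, Finset.sum_powerset]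
  refine Finset.sum_congr rfl fun m _ => ?_
  rw [elemSym, Finset.mul_sum]
  refine Finset.sum_congr rfl fun t ht => ?_
  rw [Finset.prod_mul_distrib, Finset.prod_const, (Finset.mem_powersetCard.1 ht).2]

theorem elemSym_const_mul (s : Finset ι) (a : ι → A) (c : A) (m : ℕ) :
    elemSym s (fun i => c * a i) m = c ^ m * elemSym s a m := by
  rw [elemSym, elemSym, Finset.mul_sum]
  refine Finset.sum_congr rfl fun t ht => ?_
  rw [Finset.prod_mul_distrib, Finset.prod_const, (Finset.mem_powersetCard.1 ht).2]

theorem map_elemSym {B : Type*} [CommRing B] (f : A →+* B) (s : Finset ι) (a : ι → A) (m : ℕ) :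
    elemSym s (fun i => f (a i)) m = f (elemSym s a m) := by
  simp [elemSym]

open Polynomial in
/-- If `1 + y φ i = ψ i (1 + (y - 1) b i)` for all `i`, the elementary symmetric functions of `φ`
are obtained from those of `b` by comparing coefficients of `y`. -/
theorem elemSym_eq_prod_mul_sum (s : Finset ι) (φ ψ b : ι → A) (h₁ : ∀ i, ψ i * (1 - b i) = 1)
    (h₂ : ∀ i, φ i = ψ i * b i) (d : ℕ) :
    elemSym s φ d = (∏ i ∈ s, ψ i) *
      ∑ m ∈ Finset.range (s.card + 1), (-1) ^ (m - d) * (m.choose d : A) * elemSym s b m := by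
  have key : ∏ i ∈ s, (1 + (X : A[X]) * C (φ i)) =
      C (∏ i ∈ s, ψ i) * ∏ i ∈ s, (1 + (X + C (-1) : A[X]) * C (b i)) := by
    rw [map_prod, ← Finset.prod_mul_distrib]
    refine Finset.prod_congr rfl fun i _ => ?_
    have := congrArg (C : A → A[X]) (h₁ i)
    simp only [h₂, map_mul, map_sub, map_one, map_neg] at this ⊢
    linear_combination -this
  have h := congrArg (fun p => coeff p d) key
  simp only [prod_one_add_mul_eq_sum_elemSym, map_elemSym, finsetSum_coeff, coeff_C_mul,
    coeff_mul_C, coeff_X_add_C_pow, coeff_X_pow] at h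
  rw [← h]
  simp only [ite_mul, one_mul, zero_mul, Finset.sum_ite_eq, Finset.mem_range]
  split_ifs with hd
  · rfl
  · exact elemSym_eq_zero_of_card_lt _ _ (by omega)

end FiniteIdentities

section PowerSeriesIdentities

open PowerSeries

variable {ι : Type*}

/-- The coefficient of `z ^ n` in `∏ i ∈ s, 1 / (1 - x i * z)`. -/
noncomputable def completeSym (s : Finset ι) (x : ι → ℝ) (n : ℕ) : ℝ :=
  coeff n (∏ i ∈ s, mk (fun j => x i ^ j))

/-- The sum of all monomials of degree `n` involving exactly `d` of the variables
`x i`, `i ∈ s`. -/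
noncomputable def depthSum (s : Finset ι) (x : ι → ℝ) (n d : ℕ) : ℝ :=
  coeff n (elemSym s (fun i => mk (fun j => if j = 0 then 0 else x i ^ j)) d)

theorem depthSum_eq (s : Finset ι) (x : ι → ℝ) (n d : ℕ) :
    depthSum s x n d = ∑ m ∈ Finset.range (n + 1),
      (-1) ^ (m - d) * (m.choose d : ℝ) * elemSym s x m * completeSym s x (n - m) := by
  have hgeom (r : ℝ) : mk (fun j => r ^ j) * (1 - X * C r) = 1 := by
    ext j
    rw [mul_sub, mul_one, ← mul_assoc, map_sub, coeff_mul_C]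
    cases j with
    | zero => simp
    | succ j => simp [coeff_succ_mul_X, coeff_one, pow_succ]
  have h₂ (r : ℝ) : mk (fun j => if j = 0 then 0 else r ^ j) = mk (fun j => r ^ j) * (X * C r) := by
    ext j
    rw [← mul_assoc, coeff_mul_C]
    cases j with
    | zero => simp
    | succ j => simp [coeff_succ_mul_X, pow_succ]
  rw [depthSum, elemSym_eq_prod_mul_sum s _ _ _ (fun i => hgeom (x i)) (fun i => h₂ (x i))]
  have h₃ : ∑ m ∈ Finset.range (s.card + 1), (-1) ^ (m - d) * (m.choose d : ℝ⟦X⟧) *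
      elemSym s (fun i => X * C (x i)) m =
      mk fun m => (-1) ^ (m - d) * (m.choose d : ℝ) * elemSym s x m := by
    ext k
    have (m : ℕ) : (-1) ^ (m - d) * (m.choose d : ℝ⟦X⟧) * elemSym s (fun i => X * C (x i)) m =
        C ((-1) ^ (m - d) * (m.choose d : ℝ) * elemSym s x m) * X ^ m := by
      rw [elemSym_const_mul, map_elemSym]
      simp only [map_mul, map_pow, map_neg, map_one, map_natCast]
      ring
    simp only [this, map_sum, coeff_C_mul, coeff_X_pow, coeff_mk, mul_ite, mul_one, mul_zero,
      Finset.sum_ite_eq, Finset.mem_range]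
    split_ifs with hk
    · rfl
    · rw [elemSym_eq_zero_of_card_lt _ _ (by omega), mul_zero]
  rw [h₃, mul_comm, coeff_mul, Finset.Nat.sum_antidiagonal_eq_sum_range_succ_mk]
  simp [completeSym]

theorem depthSum_zero (s : Finset ι) (x : ι → ℝ) {n : ℕ} (hn : n ≠ 0) : depthSum s x n 0 = 0 := by
  simp [depthSum, elemSym_zero, coeff_one, hn]

theorem depthSum_one (s : Finset ι) (x : ι → ℝ) {n : ℕ} (hn : n ≠ 0) :
    depthSum s x n 1 = ∑ i ∈ s, x i ^ n := by
  simp [depthSum, elemSym_one, hn]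

theorem coeff_prod_mk_ite {d : ℕ} (y : Fin d → ℝ) (n : ℕ) :
    coeff n (∏ i, mk (fun j => if j = 0 then 0 else y i ^ j)) =
      ∑ j ∈ (Finset.Nat.antidiagonalTuple d n).filter (fun j => ∀ i, 1 ≤ j i),
        ∏ i, y i ^ j i := by
  classical
  rw [coeff_prod, Finset.sum_filter]
  refine Finset.sum_nbij' (fun l => ⇑l) (fun j => Finsupp.equivFunOnFinite.symm j) ?_ ?_ ?_ ?_ ?_
  · intro l hl
    rw [Finset.mem_finsuppAntidiag] at hl
    simpa [Finset.Nat.mem_antidiagonalTuple] using hl.1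
  · intro j hj
    rw [Finset.mem_finsuppAntidiag]
    simpa [Finset.Nat.mem_antidiagonalTuple] using hj
  · intro l _
    ext; simp
  · intro j _
    ext; simp
  · intro l _
    simp only [coeff_mk]
    split_ifs with h
    · exact Finset.prod_congr rfl fun i _ => if_neg (Nat.one_le_iff_ne_zero.1 (h i))
    · push Not at h
      obtain ⟨i, hi⟩ := h
      exact Finset.prod_eq_zero (Finset.mem_univ i) (if_pos (by omega))

/-- Subsets of `range K` of size `d` correspond to strictly decreasing `d`-tuples below `K`. -/
theorem elemSym_eq_sum_strictAnti {A : Type*} [CommRing A] (K d : ℕ) (a : ℕ → A)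
    (F : Finset {f : Fin d → ℕ // StrictAnti f}) (hF : ∀ f, f ∈ F ↔ ∀ i, f.1 i < K) :
    elemSym (Finset.range K) a d = ∑ f ∈ F, ∏ i, a (f.1 i) := by
  classical
  symm
  refine Finset.sum_nbij (fun f => Finset.univ.image f.1) ?_ ?_ ?_ ?_
  · intro f hf
    rw [Finset.mem_powersetCard, Finset.card_image_of_injective _ f.2.injective]
    refine ⟨?_, by simp⟩
    intro k hk
    obtain ⟨i, -, rfl⟩ := Finset.mem_image.1 hk
    exact Finset.mem_range.2 ((hF f).1 hf i)
  · intro f _ g _ hfg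
    have : Set.range f.1 = Set.range g.1 := by
      simpa using congrArg (fun s : Finset ℕ => (s : Set ℕ)) hfg
    exact Subtype.ext ((StrictAnti.range_inj f.2 g.2).1 this)
  · intro t ht
    obtain ⟨hts, htc⟩ := Finset.mem_powersetCard.1 (Finset.mem_coe.1 ht)
    refine ⟨⟨fun i => t.orderEmbOfFin htc i.rev, fun i j hij => ?_⟩, ?_, ?_⟩
    · exact (t.orderEmbOfFin htc).strictMono (Fin.rev_lt_rev.2 hij)
    · refine Finset.mem_coe.2 ((hF _).2 fun i => ?_)
      exact Finset.mem_range.1 (hts (t.orderEmbOfFin_mem htc _))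
    · apply Finset.coe_injective
      rw [Finset.coe_image, Finset.coe_univ, Set.image_univ]
      exact (Fin.rev_surjective.range_comp _).trans (t.range_orderEmbOfFin htc)
  · intro f _
    rw [Finset.prod_image fun i _ j _ h => f.2.injective h]

end PowerSeriesIdentities

section Limits

open Filter Topology

theorem eq_zero_of_hasSum_zero {a : ℕ → ℝ}
    (h : ∀ w ∈ Set.Ioo (0 : ℝ) 1, HasSum (fun m => w ^ m * a m) 0) (m : ℕ) : a m = 0 := by
  set f : ℝ → ℝ := fun z => ∑' m, z ^ m * a m with hf
  have hp : HasFPowerSeriesAt f (FormalMultilinearSeries.ofScalars ℝ a) 0 := by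
    rw [hasFPowerSeriesAt_iff]
    filter_upwards [Metric.ball_mem_nhds (0 : ℝ) one_pos] with z hz
    simp only [FormalMultilinearSeries.coeff_ofScalars, smul_eq_mul, zero_add]
    refine Summable.hasSum ?_
    rw [Metric.mem_ball, dist_zero_right, Real.norm_eq_abs] at hz
    obtain ⟨r, hr, hr1⟩ := exists_between hz
    have hs := (h r ⟨(abs_nonneg z).trans_lt hr, hr1⟩).summable.abs
    refine Summable.of_norm_bounded hs fun m => ?_
    rw [Real.norm_eq_abs, abs_mul, abs_mul, abs_pow, abs_pow]
    exact mul_le_mul_of_nonneg_right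
      (pow_le_pow_left₀ (abs_nonneg z) (hr.le.trans (le_abs_self r)) m) (abs_nonneg _)
  have hfreq : ∃ᶠ z in 𝓝[≠] (0 : ℝ), f z = 0 := by
    have hev : ∀ᶠ z in 𝓝[>] (0 : ℝ), f z = 0 := by
      filter_upwards [Ioo_mem_nhdsGT one_pos] with z hz using (h z hz).tsum_eq
    exact hev.frequently.filter_mono (nhdsWithin_mono _ fun z hz => ne_of_gt hz)
  have hzero := hp.analyticAt.frequently_zero_iff_eventually_zero.1 hfreq
  have := hp.eq_zero_of_eventually hzero
  exact (FormalMultilinearSeries.ofScalars_eq_zero ℝ (c := a) m).1 (by rw [this]; rfl)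

/-- The reciprocal square of the `k`-th odd number. -/
noncomputable def oddInvSq (k : ℕ) : ℝ := 1 / (2 * (k : ℝ) + 1) ^ 2

theorem oddInvSq_nonneg (k : ℕ) : 0 ≤ oddInvSq k := by
  unfold oddInvSq; positivity

theorem oddInvSq_pow (k j : ℕ) : oddInvSq k ^ j = 1 / (2 * (k : ℝ) + 1) ^ (2 * j) := by
  rw [oddInvSq, div_pow, one_pow, pow_mul]

theorem summable_oddInvSq_pow {j : ℕ} (hj : 1 ≤ j) : Summable fun k => oddInvSq k ^ j := by
  have h : Summable fun k : ℕ => 1 / ((k : ℝ) ^ (2 * j)) :=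
    Real.summable_one_div_nat_pow.2 (by omega)
  have := h.comp_injective (i := fun k : ℕ => 2 * k + 1) (fun a b hab => by simpa using hab)
  simpa [oddInvSq_pow, Function.comp_def] using this

theorem summable_oddInvSq : Summable oddInvSq := by
  simpa using summable_oddInvSq_pow le_rfl

theorem tendsto_prod_one_sub_oddInvSq {u : ℝ} (hu : u ∈ Set.Ioo (0 : ℝ) 1) :
    Tendsto (fun K => ∏ k ∈ Finset.range K, (1 - u ^ 2 * oddInvSq k)) atTop
      (𝓝 (Real.cos (Real.pi * u / 2))) := by
  have hpos : 0 < Real.sin (Real.pi * (u / 2)) := by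
    apply Real.sin_pos_of_pos_of_lt_pi
    · have := Real.pi_pos; have := hu.1; positivity
    · nlinarith [Real.pi_pos, hu.2]
  have h₁ := (Real.tendsto_euler_sin_prod u).comp
    (tendsto_id.const_mul_atTop' (r := 2) two_pos)
  have h₂ := Real.tendsto_euler_sin_prod (u / 2)
  have h₃ := h₁.div (h₂.const_mul 2) (by positivity)
  have hcos : Real.sin (Real.pi * u) / (2 * Real.sin (Real.pi * (u / 2))) =
      Real.cos (Real.pi * u / 2) := by
    rw [mul_div_assoc Real.pi, div_eq_iff (by positivity),
      show Real.pi * u = 2 * (Real.pi * (u / 2)) by ring, Real.sin_two_mul]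
    ring
  rw [hcos] at h₃
  have hsplit (K : ℕ) : ∏ j ∈ Finset.range (2 * K), (1 - u ^ 2 / ((j : ℝ) + 1) ^ 2) =
      (∏ j ∈ Finset.range K, (1 - (u / 2) ^ 2 / ((j : ℝ) + 1) ^ 2)) *
        ∏ k ∈ Finset.range K, (1 - u ^ 2 * oddInvSq k) := by
    induction K with
    | zero => simp
    | succ K ih =>
      rw [show 2 * (K + 1) = 2 * K + 1 + 1 by ring, Finset.prod_range_succ,
        Finset.prod_range_succ, ih, Finset.prod_range_succ, Finset.prod_range_succ, oddInvSq]
      have : (1 - u ^ 2 / (((2 * K + 1 : ℕ) : ℝ) + 1) ^ 2) =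
          1 - (u / 2) ^ 2 / ((K : ℝ) + 1) ^ 2 := by
        push_cast
        have : (K : ℝ) + 1 ≠ 0 := by positivity
        have : (2 * K : ℝ) + 1 + 1 ≠ 0 := by positivity
        field_simp
        ring
      rw [this]
      push_cast
      ring
  refine h₃.congr fun K => ?_
  have hne : ∏ j ∈ Finset.range K, (1 - (u / 2) ^ 2 / ((j : ℝ) + 1) ^ 2) ≠ 0 := by
    refine Finset.prod_ne_zero_iff.2 fun j _ => ne_of_gt ?_
    rw [sub_pos, div_lt_one (by positivity)]
    have : (0 : ℝ) ≤ j := by positivity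
    nlinarith [hu.1, hu.2]
  have hu0 : u ≠ 0 := hu.1.ne'
  simp only [Function.comp_apply, id, Pi.div_apply]
  rw [hsplit, div_eq_iff (by have := Real.pi_pos; positivity)]
  ring

theorem elemSym_range_monotone (m : ℕ) :
    Monotone fun K => elemSym (Finset.range K) oddInvSq m := fun _ _ hKL =>
  Finset.sum_le_sum_of_subset_of_nonneg
    (Finset.powersetCard_mono (Finset.range_subset_range.2 hKL))
    fun _ _ _ => Finset.prod_nonneg fun _ _ => oddInvSq_nonneg _

theorem elemSym_nonneg (s : Finset ℕ) (m : ℕ) : 0 ≤ elemSym s oddInvSq m :=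
  Finset.sum_nonneg fun _ _ => Finset.prod_nonneg fun _ _ => oddInvSq_nonneg _

theorem elemSym_le (s : Finset ℕ) (m : ℕ) :
    elemSym s oddInvSq m ≤ Real.exp (2 * ∑' k, oddInvSq k) * (1 / 2) ^ m := by
  have h : 2 ^ m * elemSym s oddInvSq m ≤ Real.exp (2 * ∑' k, oddInvSq k) := by
    by_cases hm : s.card < m
    · rw [elemSym_eq_zero_of_card_lt _ _ hm, mul_zero]
      exact (Real.exp_pos _).le
    calc 2 ^ m * elemSym s oddInvSq m
        ≤ ∑ m ∈ Finset.range (s.card + 1), 2 ^ m * elemSym s oddInvSq m :=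
          Finset.single_le_sum (f := fun m => 2 ^ m * elemSym s oddInvSq m)
            (fun i _ => mul_nonneg (by positivity) (elemSym_nonneg s i))
            (Finset.mem_range.2 (by omega))
      _ = ∏ k ∈ s, (1 + 2 * oddInvSq k) := (prod_one_add_mul_eq_sum_elemSym s _ _).symm
      _ ≤ Real.exp (∑ k ∈ s, 2 * oddInvSq k) :=
          Real.prod_one_add_le_exp_sum s fun k => mul_nonneg two_pos.le (oddInvSq_nonneg k)
      _ ≤ _ := by
          rw [← Finset.mul_sum]
          gcongr
          exact summable_oddInvSq.sum_le_tsum s fun k _ => oddInvSq_nonneg k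
  rw [one_div_pow, mul_one_div, le_div_iff₀ (by positivity), mul_comm]
  exact h

theorem tendsto_elemSym (m : ℕ) :
    Tendsto (fun K => elemSym (Finset.range K) oddInvSq m) atTop
      (𝓝 ((Real.pi / 2) ^ (2 * m) / (2 * m).factorial)) := by
  have hex (m : ℕ) : ∃ l, Tendsto (fun K => elemSym (Finset.range K) oddInvSq m) atTop (𝓝 l) :=
    ⟨_, tendsto_atTop_ciSup (elemSym_range_monotone m)
      ⟨_, Set.forall_mem_range.2 fun K => elemSym_le (Finset.range K) m⟩⟩
  choose l hl using hex
  have hlb (m : ℕ) : |l m| ≤ Real.exp (2 * ∑' k, oddInvSq k) * (1 / 2) ^ m := by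
    rw [abs_of_nonneg (ge_of_tendsto' (hl m) fun K => elemSym_nonneg _ m)]
    exact le_of_tendsto' (hl m) fun K => elemSym_le _ m
  have hgeo : Summable fun m : ℕ => Real.exp (2 * ∑' k, oddInvSq k) * (1 / 2 : ℝ) ^ m :=
    (summable_geometric_of_lt_one (by norm_num) (by norm_num)).mul_left _
  suffices h : (-1) ^ m * (l m - (Real.pi / 2) ^ (2 * m) / (2 * m).factorial) = 0 by
    have := sub_eq_zero.1 ((mul_eq_zero.1 h).resolve_left (by simp))
    exact this ▸ hl m
  refine eq_zero_of_hasSum_zero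
    (a := fun m => (-1) ^ m * (l m - (Real.pi / 2) ^ (2 * m) / (2 * m).factorial))
    (fun w hw => ?_) m
  have hle {m : ℕ} {r : ℝ} (hr : |r| ≤ Real.exp (2 * ∑' k, oddInvSq k) * (1 / 2) ^ m) :
      ‖(-w) ^ m * r‖ ≤ Real.exp (2 * ∑' k, oddInvSq k) * (1 / 2) ^ m := by
    rw [norm_mul, norm_pow, norm_neg, Real.norm_eq_abs, Real.norm_eq_abs, abs_of_pos hw.1]
    exact (mul_le_of_le_one_left (abs_nonneg r) (pow_le_one₀ hw.1.le hw.2.le)).trans hr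
  have hu : √w ∈ Set.Ioo (0 : ℝ) 1 :=
    ⟨Real.sqrt_pos.2 hw.1, by rw [Real.sqrt_lt' one_pos]; simpa using hw.2⟩
  have hw2 : √w ^ 2 = w := Real.sq_sqrt hw.1.le
  have h₁ : Tendsto (fun K => ∑' m, (-w) ^ m * elemSym (Finset.range K) oddInvSq m) atTop
      (𝓝 (∑' m, (-w) ^ m * l m)) := by
    refine tendsto_tsum_of_dominated_convergence hgeo (fun m => (hl m).const_mul _)
      (Eventually.of_forall fun K m => hle ?_)
    rw [abs_of_nonneg (elemSym_nonneg _ m)]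
    exact elemSym_le _ m
  have h₂ := tendsto_prod_one_sub_oddInvSq hu
  have h₃ (K : ℕ) : ∏ k ∈ Finset.range K, (1 - √w ^ 2 * oddInvSq k) =
      ∑' m, (-w) ^ m * elemSym (Finset.range K) oddInvSq m := by
    rw [tsum_eq_sum (s := Finset.range (K + 1)), hw2]
    · have := prod_one_add_mul_eq_sum_elemSym (Finset.range K) oddInvSq (-w)
      rw [Finset.card_range] at this
      rw [← this]
      exact Finset.prod_congr rfl fun k _ => by ring
    · intro m hm
      rw [elemSym_eq_zero_of_card_lt _ _ (by simpa using hm), mul_zero]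
  simp only [h₃] at h₂
  have h₄ : HasSum (fun m => (-w) ^ m * l m) (Real.cos (Real.pi * √w / 2)) := by
    rw [tendsto_nhds_unique h₂ h₁]
    exact (Summable.of_norm_bounded hgeo fun m => hle (hlb m)).hasSum
  have h₅ := h₄.sub (Real.hasSum_cos (Real.pi * √w / 2))
  rw [sub_self] at h₅
  refine h₅.congr_fun fun m => ?_
  rw [show Real.pi * √w / 2 = (Real.pi / 2) * √w by ring, mul_pow _ √w, pow_mul √w, hw2, neg_pow w]
  ring

theorem exists_tendsto_completeSym (n : ℕ) :
    ∃ l, Tendsto (fun K => completeSym (Finset.range K) oddInvSq n) atTop (𝓝 l) := by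
  induction n using Nat.strong_induction_on with
  | _ n ih =>
  rcases Nat.eq_zero_or_pos n with rfl | hn
  · exact ⟨1, by simp [completeSym, ← PowerSeries.coeff_zero_eq_constantCoeff_apply]⟩
  have hrec (K : ℕ) : completeSym (Finset.range K) oddInvSq n =
      -∑ m ∈ Finset.range n, (-1) ^ (m + 1) * elemSym (Finset.range K) oddInvSq (m + 1) *
        completeSym (Finset.range K) oddInvSq (n - (m + 1)) := by
    have h := depthSum_eq (Finset.range K) oddInvSq n 0
    rw [depthSum_zero _ _ hn.ne', Finset.sum_range_succ'] at h
    simp only [Nat.choose_zero_right, Nat.cast_one, mul_one, Nat.sub_zero, elemSym_zero, pow_zero,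
      one_mul] at h
    linarith
  have hsum : ∀ m ∈ Finset.range n, ∃ l, Tendsto (fun K =>
      (-1) ^ (m + 1) * elemSym (Finset.range K) oddInvSq (m + 1) *
        completeSym (Finset.range K) oddInvSq (n - (m + 1))) atTop (𝓝 l) := fun m _ => by
    obtain ⟨l, hl⟩ := ih (n - (m + 1)) (by omega)
    exact ⟨_, ((tendsto_elemSym (m + 1)).const_mul _).mul hl⟩
  choose! l hl using hsum
  exact ⟨_, by simpa only [hrec] using (tendsto_finsetSum _ hl).neg⟩

/-- The strictly decreasing `d`-tuples of natural numbers below `K`. -/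
noncomputable def decreasingTuples (d K : ℕ) : Finset {f : Fin d → ℕ // StrictAnti f} :=
  open Classical in (Fintype.piFinset fun _ => Finset.range K).subtype _

theorem mem_decreasingTuples {d K : ℕ} (f : {f : Fin d → ℕ // StrictAnti f}) :
    f ∈ decreasingTuples d K ↔ ∀ i, f.1 i < K := by
  simp [decreasingTuples]

theorem tendsto_decreasingTuples (d : ℕ) : Tendsto (decreasingTuples d) atTop atTop := by
  refine tendsto_atTop_finset_of_monotone (fun K L hKL f hf => ?_) fun f => ?_
  · rw [mem_decreasingTuples] at hf ⊢
    exact fun i => (hf i).trans_le hKL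
  · obtain ⟨M, hM⟩ := (Set.finite_range f.1).bddAbove
    exact ⟨M + 1, (mem_decreasingTuples f).2 fun i => Nat.lt_succ_of_le (hM ⟨i, rfl⟩)⟩

theorem summable_prod_oddInvSq_pow {d : ℕ} (j : Fin d → ℕ) (hj : ∀ i, 1 ≤ j i) :
    Summable fun f : {f : Fin d → ℕ // StrictAnti f} => ∏ i, oddInvSq (f.1 i) ^ j i := by
  classical
  have hnn (f : Fin d → ℕ) : 0 ≤ ∏ i, oddInvSq (f i) ^ j i :=
    Finset.prod_nonneg fun i _ => pow_nonneg (oddInvSq_nonneg _) _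
  suffices h : Summable fun f : Fin d → ℕ => ∏ i, oddInvSq (f i) ^ j i from h.subtype _
  refine summable_of_sum_le (c := ∏ i, ∑' k, oddInvSq k ^ j i) hnn fun F => ?_
  calc ∑ f ∈ F, ∏ i, oddInvSq (f i) ^ j i
      ≤ ∑ f ∈ Fintype.piFinset fun i => F.image (· i), ∏ i, oddInvSq (f i) ^ j i :=
        Finset.sum_le_sum_of_subset_of_nonneg
          (fun f hf => Fintype.mem_piFinset.2 fun i => Finset.mem_image_of_mem _ hf)
          fun f _ _ => hnn f
    _ = ∏ i, ∑ k ∈ F.image (· i), oddInvSq k ^ j i :=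
        (Finset.prod_univ_sum (fun i => F.image (· i)) fun i k => oddInvSq k ^ j i).symm
    _ ≤ _ := Finset.prod_le_prod
        (fun i _ => Finset.sum_nonneg fun k _ => pow_nonneg (oddInvSq_nonneg _) _)
        fun i _ => (summable_oddInvSq_pow (hj i)).sum_le_tsum _
          fun k _ => pow_nonneg (oddInvSq_nonneg _) _

theorem tendsto_depthSum (n d : ℕ) :
    Tendsto (fun K => depthSum (Finset.range K) oddInvSq n d) atTop (𝓝 (Tsum n d)) := by
  have h (K : ℕ) : depthSum (Finset.range K) oddInvSq n d =
      ∑ j ∈ (Finset.Nat.antidiagonalTuple d n).filter (fun j => ∀ i, 1 ≤ j i),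
        ∑ f ∈ decreasingTuples d K, ∏ i, oddInvSq (f.1 i) ^ j i := by
    rw [depthSum, elemSym_eq_sum_strictAnti K d _ _ mem_decreasingTuples, map_sum,
      Finset.sum_comm]
    exact Finset.sum_congr rfl fun f _ => coeff_prod_mk_ite _ n
  simp only [h]
  refine tendsto_finsetSum _ fun j hj => ?_
  have hs := (summable_prod_oddInvSq_pow j (Finset.mem_filter.1 hj).2).hasSum
  have := hs.comp (tendsto_decreasingTuples d)
  simpa only [mtv, oddInvSq_pow, Function.comp_def] using this

theorem Tsum_zero_right {n : ℕ} (hn : n ≠ 0) : Tsum n 0 = 0 :=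
  tendsto_nhds_unique (tendsto_depthSum n 0) (by simp [depthSum_zero _ _ hn])

theorem Tsum_one_right {n : ℕ} (hn : 1 ≤ n) : Tsum n 1 = t1 n := by
  refine tendsto_nhds_unique (tendsto_depthSum n 1) ?_
  have hn0 : n ≠ 0 := by omega
  simp only [depthSum_one _ _ hn0]
  have := (summable_oddInvSq_pow hn).hasSum.tendsto_sum_nat
  simpa only [oddInvSq_pow, t1] using this

end Limits

section Recurrence

open Filter Topology

theorem choose_recurrence (m k : ℕ) :
    4 * ((k : ℝ) + 2) * (k + 1) * ((m + 1).choose (k + 2)) +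
      (4 * k + 2) * (k + 1) * ((m + 1).choose (k + 1)) =
      (2 * m + 2) * (2 * m + 1) * (m.choose k) := by
  have h₁ : ((m : ℝ) + 1) * m.choose k = (m + 1).choose (k + 1) * (k + 1) := by
    exact_mod_cast Nat.add_one_mul_choose_eq m k
  have h₂ : ((m + 1).choose (k + 2) : ℝ) * (k + 2) = (m + 1).choose (k + 1) * ((m : ℝ) - k) := by
    rcases le_or_gt k m with hkm | hkm
    · have := Nat.choose_succ_right_eq (m + 1) (k + 1)
      rw [show m + 1 - (k + 1) = m - k by omega] at this
      rw [← Nat.cast_sub hkm]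
      exact_mod_cast this
    · simp [Nat.choose_eq_zero_of_lt, hkm, show m + 1 < k + 2 by omega]
  linear_combination (4 * ((k : ℝ) + 1)) * h₂ - (4 * (m : ℝ) + 2) * h₁

theorem Tsum_recurrence (n k : ℕ) :
    4 * ((k : ℝ) + 2) * (k + 1) * Tsum (n + 1) (k + 2) =
      (4 * k + 2) * (k + 1) * Tsum (n + 1) (k + 1) - Real.pi ^ 2 / 4 * Tsum n k := by
  choose l hl using exists_tendsto_completeSym
  have hT (n d : ℕ) : Tsum n d = ∑ m ∈ Finset.range (n + 1), (-1) ^ (m - d) * (m.choose d : ℝ) *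
      ((Real.pi / 2) ^ (2 * m) / (2 * m).factorial) * l (n - m) := by
    refine tendsto_nhds_unique (tendsto_depthSum n d) ?_
    simp only [depthSum_eq]
    exact tendsto_finsetSum _ fun m _ => ((tendsto_elemSym m).const_mul _).mul (hl _)
  rw [hT, hT, hT, Finset.sum_range_succ' _ (n + 1), Finset.sum_range_succ' _ (n + 1)]
  simp only [Nat.choose_zero_succ, Nat.cast_zero, mul_zero, zero_mul, add_zero, Finset.mul_sum]
  rw [← Finset.sum_sub_distrib]
  refine Finset.sum_congr rfl fun m _ => ?_
  rw [Nat.add_sub_add_right n 1 m, Nat.add_sub_add_right m 1 k]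
  have hfac : ((2 * (m + 1)).factorial : ℝ) = (2 * m + 2) * (2 * m + 1) * (2 * m).factorial := by
    rw [show 2 * (m + 1) = 2 * m + 1 + 1 by ring, Nat.factorial_succ, Nat.factorial_succ]
    push_cast
    ring
  have hf : ((2 * m).factorial : ℝ) ≠ 0 := by positivity
  have hE : Real.pi ^ 2 / 4 * ((Real.pi / 2) ^ (2 * m) / (2 * m).factorial) =
      (2 * m + 2) * (2 * m + 1) *
        ((Real.pi / 2) ^ (2 * (m + 1)) / (2 * (m + 1)).factorial) := by
    have : (2 * (m : ℝ) + 1) ≠ 0 := by positivity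
    have : (2 * (m : ℝ) + 2) ≠ 0 := by positivity
    rw [hfac]
    field_simp
    ring
  set E := (Real.pi / 2) ^ (2 * (m + 1)) / ((2 * (m + 1)).factorial : ℝ)
  have hc := choose_recurrence m k
  have hs₁ : (-1 : ℝ) ^ (m + 1 - (k + 2)) * ((m + 1).choose (k + 2)) =
      -((-1) ^ (m - k) * ((m + 1).choose (k + 2))) := by
    rcases le_or_gt (k + 1) m with h | h
    · rw [show m - k = m + 1 - (k + 2) + 1 by omega, pow_succ]
      ring
    · simp [Nat.choose_eq_zero_of_lt, show m + 1 < k + 2 by omega]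
  rw [hs₁]
  linear_combination (-(-1) ^ (m - k) * E * l (n - m)) * hc +
    (-1) ^ (m - k) * (m.choose k) * l (n - m) * hE

/-- The coefficient of `t(2n - 2j)` in the depth `d` sum formula, extended by zero. -/
noncomputable def sumFormulaCoeff (d j : ℕ) : ℝ :=
  if 2 * j + 1 ≤ d then
    (-1) ^ j * Real.pi ^ (2 * j) / (2 ^ (2 * d - 2) * (2 * j).factorial * d) *
      ((2 * d - 2 * j - 2).choose (d - 1))
  else 0

theorem sumFormulaCoeff_recurrence_zero (k : ℕ) :
    4 * ((k : ℝ) + 2) * (k + 1) * sumFormulaCoeff (k + 2) 0 =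
      (4 * k + 2) * (k + 1) * sumFormulaCoeff (k + 1) 0 := by
  have h : ((k : ℝ) + 1) * (2 * (k + 1)).choose (k + 1) = 2 * (2 * k + 1) * (2 * k).choose k := by
    exact_mod_cast Nat.succ_mul_centralBinom_succ k
  simp only [sumFormulaCoeff, show 2 * 0 + 1 ≤ k + 2 by omega, show 2 * 0 + 1 ≤ k + 1 by omega,
    if_true, show 2 * (k + 2) - 2 * 0 - 2 = 2 * (k + 1) by omega,
    show 2 * (k + 1) - 2 * 0 - 2 = 2 * k by omega, show 2 * (k + 2) - 2 = 2 * k + 2 by omega,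
    show 2 * (k + 1) - 2 = 2 * k by omega, show k + 2 - 1 = k + 1 by omega,
    show k + 1 - 1 = k by omega]
  push_cast
  rw [pow_add]
  field_simp
  linear_combination 4 * h

theorem sumFormulaCoeff_recurrence_succ (k j : ℕ) :
    4 * ((k : ℝ) + 2) * (k + 1) * sumFormulaCoeff (k + 2) (j + 1) =
      (4 * k + 2) * (k + 1) * sumFormulaCoeff (k + 1) (j + 1) -
        Real.pi ^ 2 / 4 * sumFormulaCoeff k j := by
  rcases lt_or_ge k (2 * j + 1) with hk | hk
  · simp [sumFormulaCoeff, show ¬ 2 * (j + 1) + 1 ≤ k + 2 by omega,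
      show ¬ 2 * (j + 1) + 1 ≤ k + 1 by omega, show ¬ 2 * j + 1 ≤ k by omega]
  obtain ⟨p, rfl⟩ := Nat.exists_eq_add_of_le' (show 1 ≤ k by omega)
  obtain ⟨a, ha⟩ : ∃ a, a + 2 * j = 2 * p := ⟨2 * p - 2 * j, by omega⟩
  have hmid : sumFormulaCoeff (p + 2) (j + 1) =
      (-1) ^ (j + 1) * Real.pi ^ (2 * (j + 1)) /
        (2 ^ (2 * p + 2) * (2 * (j + 1)).factorial * ((p : ℝ) + 2)) * (a.choose (p + 1)) := by
    rw [sumFormulaCoeff, show 2 * (p + 2) - 2 = 2 * p + 2 by omega,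
      show 2 * (p + 2) - 2 * (j + 1) - 2 = a by omega, show p + 2 - 1 = p + 1 by omega]
    split_ifs with h
    · push_cast
      rfl
    · rw [Nat.choose_eq_zero_of_lt (show a < p + 1 by omega), Nat.cast_zero, mul_zero]
  have hB₁ : (a.choose (p + 1) : ℝ) = a.choose p * ((a : ℝ) - p) / (p + 1) := by
    rw [eq_div_iff (by positivity), ← Nat.cast_sub (show p ≤ a by omega)]
    exact_mod_cast Nat.choose_succ_right_eq a p
  have hB₂ : ((a + 2).choose (p + 2) : ℝ) =
      a.choose p * ((a : ℝ) + 2) * (a + 1) / ((p + 2) * (p + 1)) := by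
    have h₁ : ((a : ℝ) + 1 + 1) * (a + 1).choose (p + 1) =
        (a + 2).choose (p + 2) * ((p : ℝ) + 1 + 1) := by
      exact_mod_cast Nat.add_one_mul_choose_eq (a + 1) (p + 1)
    have h₂ : ((a : ℝ) + 1) * a.choose p = (a + 1).choose (p + 1) * ((p : ℝ) + 1) := by
      exact_mod_cast Nat.add_one_mul_choose_eq a p
    rw [eq_div_iff (by positivity)]
    linear_combination (-((p : ℝ) + 1)) * h₁ - ((a : ℝ) + 2) * h₂
  have hfac : ((2 * (j + 1)).factorial : ℝ) = (2 * j + 2) * (2 * j + 1) * (2 * j).factorial := by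
    rw [show 2 * (j + 1) = 2 * j + 1 + 1 by ring, Nat.factorial_succ, Nat.factorial_succ]
    push_cast
    ring
  have haR : (a : ℝ) = 2 * p - 2 * j := by
    have : (a : ℝ) + 2 * j = 2 * p := by exact_mod_cast ha
    linarith
  rw [show p + 1 + 1 = p + 2 by ring, hmid, sumFormulaCoeff, if_pos (by omega), sumFormulaCoeff,
    if_pos (by omega), show 2 * (p + 1 + 2) - 2 = 2 * p + 4 by omega,
    show 2 * (p + 1 + 2) - 2 * (j + 1) - 2 = a + 2 by omega, show p + 1 + 2 - 1 = p + 2 by omega,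
    show 2 * (p + 1) - 2 = 2 * p by omega, show 2 * (p + 1) - 2 * j - 2 = a by omega,
    show p + 1 - 1 = p by omega, hB₁, hB₂, hfac, haR]
  have : (2 * (j : ℝ) + 1) ≠ 0 := by positivity
  push_cast
  field_simp
  ring

theorem Tsum_eq_sum_sumFormulaCoeff (d : ℕ) : ∀ n, 1 ≤ n → d ≤ n →
    Tsum n d = ∑ j ∈ Finset.range n, sumFormulaCoeff d j * t1 (n - j) := by
  induction d using Nat.strong_induction_on with
  | _ d ih =>
  intro n hn hdn
  match d with
  | 0 => simp [Tsum_zero_right (show n ≠ 0 by omega), sumFormulaCoeff]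
  | 1 =>
    obtain ⟨n, rfl⟩ := Nat.exists_eq_add_of_le' hn
    simp [Tsum_one_right hn, sumFormulaCoeff]
  | k + 2 =>
    obtain ⟨n, rfl⟩ := Nat.exists_eq_add_of_le' hn
    have hpos : 4 * ((k : ℝ) + 2) * (k + 1) ≠ 0 := by positivity
    apply mul_left_cancel₀ hpos
    have hsum : 4 * ((k : ℝ) + 2) * (k + 1) *
        ∑ j ∈ Finset.range n, sumFormulaCoeff (k + 2) (j + 1) * t1 (n - j) =
        (4 * k + 2) * (k + 1) *
          ∑ j ∈ Finset.range n, sumFormulaCoeff (k + 1) (j + 1) * t1 (n - j) -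
        Real.pi ^ 2 / 4 * ∑ j ∈ Finset.range n, sumFormulaCoeff k j * t1 (n - j) := by
      rw [Finset.mul_sum, Finset.mul_sum, Finset.mul_sum, ← Finset.sum_sub_distrib]
      refine Finset.sum_congr rfl fun j _ => ?_
      linear_combination t1 (n - j) * sumFormulaCoeff_recurrence_succ k j
    rw [Tsum_recurrence, ih (k + 1) (by omega) (n + 1) hn (by omega),
      ih k (by omega) n (by omega) (by omega), Finset.sum_range_succ', Finset.sum_range_succ']
    simp only [Nat.add_sub_add_right]
    linear_combination -hsum - t1 (n + 1 - 0) * sumFormulaCoeff_recurrence_zero k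

end Recurrence

/-- Sum formula for multiple t-values at even arguments (Theorem 1.1, first form). -/
theorem T2n_d_sum_formula (n d : ℕ) (hd : 1 ≤ d) (hdn : d ≤ n) :
    Tsum n d = ∑ j ∈ Finset.range ((d - 1) / 2 + 1),
      ((-1) ^ j * Real.pi ^ (2 * j) / (2 ^ (2 * d - 2) * (2 * j).factorial * d)) *
        ((2 * d - 2 * j - 2).choose (d - 1)) * t1 (n - j) := by
  rw [Tsum_eq_sum_sumFormulaCoeff d n (hd.trans hdn) hdn]
  symm
  rw [← Finset.sum_subset (Finset.range_subset_range.2 (show (d - 1) / 2 + 1 ≤ n by omega))]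
  · refine Finset.sum_congr rfl fun j hj => ?_
    rw [Finset.mem_range] at hj
    rw [sumFormulaCoeff, if_pos (by omega)]
  · intro j _ hj
    rw [Finset.mem_range] at hj
    rw [sumFormulaCoeff, if_neg (by omega), zero_mul]
end

section
/- For all integers n and d with 1 ≤ d ≤ n, T(2n,d) = ((-1)^{n-d} π^{2n} / (4^n (2n)!)) · Σ_{ℓ=0}^{n-d} C(n-ℓ, d) · C(2n, 2ℓ) · E_{2ℓ}, where C(a,b) denotes the binomial coefficient and E_{2ℓ} are the Euler numbers. -/
open scoped BigOperators

/-- Euler numbers: `eulerE n = E_{2n}`, uniquely determined by `E_0 = 1` and the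
recurrence `∑_{k=0}^{n} C(2n, 2k) E_{2k} = 0` for all `n ≥ 1`. -/
def eulerE : ℕ → ℤ
  | 0 => 1
  | n + 1 => -∑ k : Fin (n + 1), ((2 * (n + 1)).choose (2 * (k : ℕ)) : ℤ) * eulerE k
  decreasing_by exact k.is_lt

open Finset Filter Topology

namespace MultipleTValue

section Combinatorics

/-- Summing a product over strictly decreasing tuples below `N` amounts to summing over
`d`-element subsets of `range N`. -/
lemma sum_strictAnti_eq_sum_powersetCard {M : Type*} [CommSemiring M] (φ : ℕ → M) (d N : ℕ) :
    ∑ f ∈ (Fintype.piFinset fun _ : Fin d => range N).filter StrictAnti, ∏ i, φ (f i) =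
      ∑ S ∈ powersetCard d (range N), ∏ s ∈ S, φ s := by
  refine sum_nbij (fun f => univ.image f) ?_ ?_ ?_ ?_
  · intro f hf
    simp only [mem_filter, Fintype.mem_piFinset] at hf
    rw [mem_powersetCard]
    refine ⟨image_subset_iff.2 fun i _ => hf.1 i, ?_⟩
    rw [card_image_of_injective _ hf.2.injective, card_univ, Fintype.card_fin]
  · intro f hf g hg h
    simp only [coe_filter, Set.mem_ofPred_eq] at hf hg
    refine (hf.2.range_inj hg.2).1 ?_
    simpa using congrArg (fun s : Finset ℕ => (s : Set ℕ)) h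
  · intro S hS
    rw [mem_coe, mem_powersetCard] at hS
    refine ⟨S.orderEmbOfFin hS.2 ∘ Fin.rev, ?_, ?_⟩
    · simp only [coe_filter, Set.mem_ofPred_eq, Fintype.mem_piFinset]
      exact ⟨fun i => hS.1 (S.orderEmbOfFin_mem hS.2 _),
        (S.orderEmbOfFin hS.2).strictMono.comp_strictAnti Fin.rev_strictAnti⟩
    · apply coe_injective
      rw [coe_image, coe_univ, Set.image_univ, Fin.rev_surjective.range_comp,
        range_orderEmbOfFin]
  · intro f hf
    simp only [mem_filter] at hf
    rw [prod_image hf.2.injective.injOn]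

open Polynomial in
/-- Comparison of the coefficients of `X ^ d` in `∏ (1 - α + α X) = ∏ (1 + (X - 1) α)`. -/
lemma sum_powersetCard_mul_prod_one_sub {R : Type*} [CommRing R] (φ α : ℕ → R)
    (h : ∀ m, (1 - α m) * φ m = α m) (d : ℕ) (s : Finset ℕ) :
    (∑ S ∈ powersetCard d s, ∏ i ∈ S, φ i) * ∏ i ∈ s, (1 - α i) =
      ∑ S ∈ s.powerset, (-1) ^ (#S + d) * ((#S).choose d : R) * ∏ i ∈ S, α i := by
  have key : C (∏ i ∈ s, (1 - α i)) * ∏ i ∈ s, (1 + X * C (φ i)) =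
      ∏ i ∈ s, (1 + (X - 1) * C (α i)) := by
    rw [map_prod, ← prod_mul_distrib]
    refine prod_congr rfl fun i _ => ?_
    have h' := congrArg (C : R → R[X]) (h i)
    simp only [map_mul, map_sub, map_one] at h' ⊢
    linear_combination X * h'
  have key' := congrArg (fun p => coeff p d) key
  simp only [prod_one_add, coeff_C_mul, finsetSum_coeff, prod_mul_distrib, prod_const,
    ← map_prod, coeff_mul_C] at key'
  have hsign (n : ℕ) : ((X - 1 : R[X]) ^ n).coeff d = (-1) ^ (n + d) * (n.choose d : R) := by
    rw [← map_one C, sub_eq_add_neg, ← map_neg C, coeff_X_add_C_pow]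
    rcases lt_or_ge n d with hnd | hnd
    · simp [Nat.choose_eq_zero_of_lt hnd]
    · obtain ⟨c, rfl⟩ := Nat.exists_eq_add_of_le hnd
      rw [Nat.add_sub_cancel_left, show d + c + d = c + 2 * d by ring, pow_add _ c, pow_mul]
      simp
  simp only [hsign] at key'
  rw [← key', mul_comm, powersetCard_eq_filter, sum_filter]
  congr 1
  refine sum_congr rfl fun S _ => ?_
  simp [coeff_X_pow, eq_comm]

end Combinatorics

section Series

/-- The geometric series without constant term, `a X / (1 - a X)`. -/
noncomputable def geomTail (a : ℝ) : PowerSeries ℝ :=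
  PowerSeries.mk fun j => if 1 ≤ j then a ^ j else 0

lemma one_sub_mul_geomTail (a : ℝ) :
    (1 - PowerSeries.C a * PowerSeries.X) * geomTail a = PowerSeries.C a * PowerSeries.X := by
  ext n
  rw [sub_mul, one_mul, mul_assoc, map_sub, PowerSeries.coeff_C_mul, PowerSeries.coeff_C_mul]
  rcases n with _ | _ | n
  · simp [geomTail]
  · simp [geomTail, PowerSeries.coeff_succ_X_mul]
  · simp [geomTail, PowerSeries.coeff_succ_X_mul, PowerSeries.coeff_X, pow_succ]
    ring

lemma coeff_prod_geomTail {d : ℕ} (b : Fin d → ℝ) (n : ℕ) :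
    PowerSeries.coeff n (∏ i, geomTail (b i)) =
      ∑ j ∈ (Finset.Nat.antidiagonalTuple d n).filter (fun j => ∀ i, 1 ≤ j i),
        ∏ i, b i ^ j i := by
  classical
  rw [PowerSeries.coeff_prod, sum_filter]
  refine sum_nbij' (fun l => l) (fun j => Finsupp.equivFunOnFinite.symm j) ?_ ?_ ?_ ?_ ?_
  · intro l hl
    simpa [Finset.Nat.mem_antidiagonalTuple] using hl
  · intro j hj
    simpa [Finset.Nat.mem_antidiagonalTuple] using hj
  · intro l _
    ext; simp
  · intro j _
    ext; simp
  · intro l _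
    simp only [geomTail, PowerSeries.coeff_mk]
    split_ifs with h
    · exact prod_congr rfl fun i _ => if_pos (h i)
    · push Not at h
      obtain ⟨i, hi⟩ := h
      exact prod_eq_zero (mem_univ i) (if_neg hi.not_ge)

lemma coeff_sum_signed_powerset (a : ℕ → ℝ) (d n : ℕ) (s : Finset ℕ) :
    PowerSeries.coeff n (∑ S ∈ s.powerset, (-1) ^ (#S + d) * ((#S).choose d : PowerSeries ℝ) *
        ∏ i ∈ S, (PowerSeries.C (a i) * PowerSeries.X)) =
      (-1) ^ (n + d) * (n.choose d : ℝ) * ∑ S ∈ powersetCard n s, ∏ i ∈ S, a i := by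
  rw [map_sum, powersetCard_eq_filter, sum_filter, mul_sum]
  refine sum_congr rfl fun S _ => ?_
  have hC : (-1) ^ (#S + d) * ((#S).choose d : PowerSeries ℝ) *
      ∏ i ∈ S, (PowerSeries.C (a i) * PowerSeries.X) =
      PowerSeries.C ((-1) ^ (#S + d) * ((#S).choose d : ℝ) * ∏ i ∈ S, a i) *
        PowerSeries.X ^ #S := by
    simp [prod_mul_distrib, mul_assoc]
  rw [hC, PowerSeries.coeff_C_mul, PowerSeries.coeff_X_pow]
  split_ifs with h1 h2 h2
  · rw [h1, mul_one]
  · exact absurd h1.symm h2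
  · exact absurd h2.symm h1
  · simp

end Series

section Limits

lemma summable_one_div_odd_pow {k : ℕ} (hk : 2 ≤ k) :
    Summable fun m : ℕ => 1 / (2 * (m : ℝ) + 1) ^ k := by
  have h := (Real.summable_one_div_nat_pow (p := k)).2 (by omega)
  have h' := h.comp_injective (i := fun m : ℕ => 2 * m + 1) (fun a b h => by simpa using h)
  refine h'.congr fun m => ?_
  simp

/-- Truncations of a multiple t-value with all arguments at least `2` converge to it. -/
lemma tendsto_truncated_mtv {d : ℕ} (s : Fin d → ℕ) (hs : ∀ i, 2 ≤ s i) :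
    Tendsto (fun N => ∑ f ∈ (Fintype.piFinset fun _ : Fin d => range N).filter StrictAnti,
      ∏ i, 1 / (2 * (f i : ℝ) + 1) ^ s i) atTop (𝓝 (mtv d s)) := by
  classical
  have hsum : Summable fun f : Fin d → ℕ => ∏ i, 1 / (2 * (f i : ℝ) + 1) ^ s i := by
    refine summable_of_sum_le (c := ∏ i, ∑' m : ℕ, 1 / (2 * (m : ℝ) + 1) ^ s i)
      (fun f => prod_nonneg fun i _ => by positivity) fun u => ?_
    calc ∑ f ∈ u, ∏ i, 1 / (2 * (f i : ℝ) + 1) ^ s i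
        ≤ ∑ f ∈ Fintype.piFinset fun i => u.image fun f : Fin d → ℕ => f i,
            ∏ i, 1 / (2 * (f i : ℝ) + 1) ^ s i := by
          refine sum_le_sum_of_subset_of_nonneg (fun f hf => ?_)
            fun f _ _ => prod_nonneg fun i _ => by positivity
          exact Fintype.mem_piFinset.2 fun i => mem_image_of_mem _ hf
      _ = ∏ i, ∑ m ∈ u.image fun f : Fin d → ℕ => f i, 1 / (2 * (m : ℝ) + 1) ^ s i :=
          (prod_univ_sum _ fun i (m : ℕ) => 1 / (2 * (m : ℝ) + 1) ^ s i).symm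
      _ ≤ _ := by
          refine prod_le_prod (fun i _ => sum_nonneg fun m _ => by positivity) fun i _ => ?_
          exact (summable_one_div_odd_pow (hs i)).sum_le_tsum _ fun m _ => by positivity
  have hsub : Summable fun f : {f : Fin d → ℕ // StrictAnti f} =>
      ∏ i, 1 / (2 * (f.1 i : ℝ) + 1) ^ s i := hsum.subtype _
  have hlim := hsub.hasSum.comp (tendsto_atTop_finset_of_monotone
    (f := fun N => (Fintype.piFinset fun _ : Fin d => range N).subtype StrictAnti) ?_ ?_)
  · refine hlim.congr fun N => ?_
    simp only [Function.comp_apply]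
    rw [← sum_subtype_eq_sum_filter]
  · intro M N hMN f hf
    simp only [mem_subtype, Fintype.mem_piFinset, mem_range] at hf ⊢
    exact fun i => (hf i).trans_le hMN
  · intro f
    refine ⟨(∑ i, f.1 i) + 1, ?_⟩
    simp only [mem_subtype, Fintype.mem_piFinset, mem_range]
    exact fun i => Nat.lt_succ_of_le (single_le_sum (fun _ _ => Nat.zero_le _) (mem_univ i))

/-- The elementary symmetric sum of degree `k` in the first `N` numbers `1 / (2m+1)²`. -/
noncomputable def oddESymm (k N : ℕ) : ℝ :=
  ∑ S ∈ powersetCard k (range N), ∏ m ∈ S, 1 / (2 * (m : ℝ) + 1) ^ 2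

lemma oddESymm_nonneg (k N : ℕ) : 0 ≤ oddESymm k N :=
  sum_nonneg fun _ _ => prod_nonneg fun _ _ => by positivity

lemma tendsto_oddESymm_mtv (k : ℕ) :
    Tendsto (oddESymm k) atTop (𝓝 (mtv k fun _ => 2)) := by
  refine (tendsto_truncated_mtv (fun _ : Fin k => 2) fun _ => le_rfl).congr fun N => ?_
  exact sum_strictAnti_eq_sum_powersetCard (fun m : ℕ => 1 / (2 * (m : ℝ) + 1) ^ 2) k N

lemma oddESymm_le (k N : ℕ) : oddESymm k N ≤ (∑' m : ℕ, 1 / (2 * (m : ℝ) + 1) ^ 2) ^ k := by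
  rw [oddESymm, ← sum_strictAnti_eq_sum_powersetCard (fun m : ℕ => 1 / (2 * (m : ℝ) + 1) ^ 2)]
  calc _ ≤ ∑ f ∈ Fintype.piFinset fun _ : Fin k => range N,
          ∏ i, 1 / (2 * (f i : ℝ) + 1) ^ 2 :=
        sum_le_sum_of_subset_of_nonneg (filter_subset _ _)
          fun f _ _ => prod_nonneg fun i _ => by positivity
    _ = (∑ m ∈ range N, 1 / (2 * (m : ℝ) + 1) ^ 2) ^ k := by
        rw [← prod_univ_sum (fun _ : Fin k => range N)
          fun _ (m : ℕ) => 1 / (2 * (m : ℝ) + 1) ^ 2]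
        simp
    _ ≤ _ := by
        gcongr
        exact (summable_one_div_odd_pow le_rfl).sum_le_tsum _ fun m _ => by positivity

end Limits

section Cosine

lemma tendsto_euler_cos_prod {x : ℂ} (hx : x ≠ 0) (hx1 : ‖x‖ < 1) :
    Tendsto (fun N : ℕ => ∏ m ∈ range N, (1 - x ^ 2 / (2 * (m : ℂ) + 1) ^ 2)) atTop
      (𝓝 (Complex.cos (Real.pi * x / 2))) := by
  have hsin : Complex.sin (Real.pi * (x / 2)) ≠ 0 := by
    rw [Ne, Complex.sin_eq_zero_iff]
    rintro ⟨k, hk⟩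
    have hpi : (Real.pi : ℂ) ≠ 0 := by exact_mod_cast Real.pi_ne_zero
    have hxk : x = 2 * (k : ℂ) := by
      have : (Real.pi : ℂ) * (x - 2 * k) = 0 := by linear_combination 2 * hk
      exact sub_eq_zero.1 ((mul_eq_zero.1 this).resolve_left hpi)
    have hk0 : k ≠ 0 := by rintro rfl; simp [hxk] at hx
    have h1 : (1 : ℝ) ≤ |(k : ℝ)| := by exact_mod_cast Int.one_le_abs hk0
    rw [hxk, norm_mul, Complex.norm_intCast, Complex.norm_ofNat] at hx1
    linarith
  have hfull := (Complex.tendsto_euler_sin_prod x).comp (tendsto_id.const_mul_atTop' two_pos)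
  have hhalf := Complex.tendsto_euler_sin_prod (x / 2)
  have hdiv := hfull.div (hhalf.const_mul 2) (mul_ne_zero two_ne_zero hsin)
  have hval : Complex.sin (Real.pi * x) / (2 * Complex.sin (Real.pi * (x / 2))) =
      Complex.cos (Real.pi * x / 2) := by
    rw [div_eq_iff (mul_ne_zero two_ne_zero hsin),
      show (Real.pi : ℂ) * x = 2 * (Real.pi * (x / 2)) by ring, Complex.sin_two_mul,
      show 2 * ((Real.pi : ℂ) * (x / 2)) / 2 = Real.pi * (x / 2) by ring]
    ring
  rw [hval] at hdiv
  refine hdiv.congr' ?_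
  filter_upwards [hhalf.eventually_ne hsin] with N hN
  simp only [Function.comp_apply, id, Pi.div_apply]
  rw [div_eq_iff (mul_ne_zero two_ne_zero hN)]
  have hsplit : ∏ j ∈ range (2 * N), (1 - x ^ 2 / ((j : ℂ) + 1) ^ 2) =
      (∏ m ∈ range N, (1 - x ^ 2 / (2 * (m : ℂ) + 1) ^ 2)) *
        ∏ j ∈ range N, (1 - (x / 2) ^ 2 / ((j : ℂ) + 1) ^ 2) := by
    clear hN
    induction N with
    | zero => simp
    | succ N ih =>
      rw [show 2 * (N + 1) = 2 * N + 1 + 1 by ring, prod_range_succ, prod_range_succ, ih,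
        prod_range_succ _ N, prod_range_succ _ N]
      have : x ^ 2 / (((2 * N + 1 : ℕ) : ℂ) + 1) ^ 2 = (x / 2) ^ 2 / ((N : ℂ) + 1) ^ 2 := by
        rw [show ((2 * N + 1 : ℕ) : ℂ) + 1 = 2 * ((N : ℂ) + 1) by push_cast; ring, mul_pow,
          div_pow, div_div]
      rw [this]
      push_cast
      ring
  rw [hsplit]
  ring

lemma prod_one_sub_eq_tsum (u : ℂ) (N : ℕ) :
    ∏ m ∈ range N, (1 - u / (2 * (m : ℂ) + 1) ^ 2) =
      ∑' k, (-u) ^ k * (oddESymm k N : ℂ) := by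
  rw [tsum_eq_sum (s := range (N + 1))]
  · have h := sum_powerset (range N) fun S => ∏ m ∈ S, -(u / (2 * (m : ℂ) + 1) ^ 2)
    rw [card_range] at h
    simp only [sub_eq_add_neg]
    rw [prod_one_add, h]
    refine sum_congr rfl fun k _ => ?_
    rw [oddESymm, Complex.ofReal_sum, mul_sum]
    refine sum_congr rfl fun S hS => ?_
    rw [← (mem_powersetCard.1 hS).2, ← prod_const, Complex.ofReal_prod, ← prod_mul_distrib]
    refine prod_congr rfl fun m _ => ?_
    push_cast
    ring
  · intro k hk
    have : oddESymm k N = 0 := by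
      rw [oddESymm, powersetCard_eq_empty.2, sum_empty]
      simpa using hk
    simp [this]

lemma eq_of_eventually_hasSum {a b : ℕ → ℂ} {F : ℂ → ℂ}
    (ha : ∀ᶠ u in 𝓝 (0 : ℂ), HasSum (fun k => u ^ k * a k) (F u))
    (hb : ∀ᶠ u in 𝓝 (0 : ℂ), HasSum (fun k => u ^ k * b k) (F u)) : a = b := by
  have ha' : HasFPowerSeriesAt F (FormalMultilinearSeries.ofScalars ℂ a) 0 := by
    rw [hasFPowerSeriesAt_iff]
    simpa [FormalMultilinearSeries.coeff_ofScalars] using ha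
  have hb' : HasFPowerSeriesAt F (FormalMultilinearSeries.ofScalars ℂ b) 0 := by
    rw [hasFPowerSeriesAt_iff]
    simpa [FormalMultilinearSeries.coeff_ofScalars] using hb
  have h := ha'.eq_formalMultilinearSeries hb'
  funext n
  simpa [FormalMultilinearSeries.coeff_ofScalars] using
    congrArg (fun p : FormalMultilinearSeries ℂ ℂ ℂ => p.coeff n) h

/-- `t({2}^k) = (π/2)^{2k} / (2k)!`. -/
lemma mtv_two (k : ℕ) :
    mtv k (fun _ => 2) = (Real.pi / 2) ^ (2 * k) / (2 * k).factorial := by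
  set A : ℝ := ∑' m : ℕ, 1 / (2 * (m : ℝ) + 1) ^ 2
  have hA0 : 0 ≤ A := tsum_nonneg fun m => by positivity
  have hmtv (k : ℕ) : |mtv k fun _ => 2| ≤ A ^ k := by
    rw [abs_of_nonneg (ge_of_tendsto' (tendsto_oddESymm_mtv k) (oddESymm_nonneg k))]
    exact le_of_tendsto' (tendsto_oddESymm_mtv k) (oddESymm_le k)
  have hsmall : ∀ᶠ u in 𝓝 (0 : ℂ), ‖u‖ < 1 / (A + 1) := by
    filter_upwards [Metric.ball_mem_nhds (0 : ℂ) (ε := 1 / (A + 1)) (by positivity)] with u hu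
    simpa using hu
  have hratio {u : ℂ} (hu : ‖u‖ < 1 / (A + 1)) : ‖u‖ * A < 1 := by
    rw [lt_div_iff₀ (by positivity)] at hu
    nlinarith [norm_nonneg u]
  have hmain : (fun k => (-1 : ℂ) ^ k * (mtv k (fun _ => 2) : ℂ)) =
      fun k => (-1 : ℂ) ^ k * ((Real.pi / 2) ^ (2 * k) / (2 * k).factorial : ℝ) := by
    refine eq_of_eventually_hasSum
      (F := fun u => ∑' k, u ^ k * ((-1 : ℂ) ^ k * (mtv k (fun _ => 2) : ℂ))) ?_ ?_
    · filter_upwards [hsmall] with u hu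
      refine Summable.hasSum (.of_norm_bounded (g := fun k => (‖u‖ * A) ^ k)
        (summable_geometric_of_lt_one (by positivity) (hratio hu)) fun k => ?_)
      simp only [norm_mul, norm_pow, norm_neg, norm_one, one_pow, one_mul, mul_pow,
        Complex.norm_real, Real.norm_eq_abs]
      gcongr
      exact hmtv k
    · filter_upwards [hsmall] with u hu
      obtain ⟨x, rfl⟩ := IsAlgClosed.exists_pow_nat_eq u two_pos
      have hcos : HasSum (fun k => (x ^ 2) ^ k *
          ((-1 : ℂ) ^ k * ((Real.pi / 2) ^ (2 * k) / (2 * k).factorial : ℝ)))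
          (Complex.cos (Real.pi * x / 2)) := by
        refine (Complex.hasSum_cos (Real.pi * x / 2)).congr_fun fun k => ?_
        push_cast
        rw [← pow_mul, div_pow, div_pow, mul_pow]
        ring
      convert hcos using 1
      rcases eq_or_ne x 0 with rfl | hx
      · rw [tsum_eq_single 0 fun k (hk : k ≠ 0) => by
          rw [zero_pow two_ne_zero, zero_pow hk, zero_mul]]
        have h0 : mtv 0 (fun _ => 2) = 1 := by
          exact tendsto_nhds_unique (tendsto_oddESymm_mtv 0)
            (tendsto_const_nhds.congr fun N => by simp [oddESymm])
        simp [h0]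
      have hx1 : ‖x‖ < 1 := by
        have : ‖x ^ 2‖ < 1 := hu.trans_le (by
          rw [div_le_one (by positivity)]; linarith)
        rw [norm_pow] at this
        nlinarith [norm_nonneg x]
      refine tendsto_nhds_unique ?_ (tendsto_euler_cos_prod hx hx1)
      simp_rw [prod_one_sub_eq_tsum]
      refine tendsto_tsum_of_dominated_convergence (bound := fun k => (‖x ^ 2‖ * A) ^ k)
        (summable_geometric_of_lt_one (by positivity) (hratio hu)) (fun k => ?_)
        (.of_forall fun N k => ?_)
      · rw [← mul_assoc, ← mul_pow, mul_neg_one]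
        exact ((Complex.continuous_ofReal.tendsto _).comp (tendsto_oddESymm_mtv k)).const_mul _
      · rw [norm_mul, norm_pow, norm_neg, Complex.norm_real, Real.norm_eq_abs,
          abs_of_nonneg (oddESymm_nonneg k N), mul_pow]
        gcongr
        exact oddESymm_le k N
  have h := congrFun hmain k
  exact_mod_cast mul_left_cancel₀ (pow_ne_zero k (neg_ne_zero.2 one_ne_zero)) h

end Cosine

/-- `Tsum n d` is a limit of coefficients of elementary symmetric sums of geometric series. -/
lemma tendsto_coeff_Tsum (n d : ℕ) :
    Tendsto (fun N => PowerSeries.coeff n (∑ S ∈ powersetCard d (range N),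
      ∏ m ∈ S, geomTail (1 / (2 * (m : ℝ) + 1) ^ 2))) atTop (𝓝 (Tsum n d)) := by
  have h : Tendsto (fun N => ∑ j ∈ (Finset.Nat.antidiagonalTuple d n).filter
      (fun j => ∀ i, 1 ≤ j i),
      ∑ f ∈ (Fintype.piFinset fun _ : Fin d => range N).filter StrictAnti,
        ∏ i, 1 / (2 * (f i : ℝ) + 1) ^ (2 * j i)) atTop (𝓝 (Tsum n d)) := by
    refine tendsto_finsetSum _ fun j hj => tendsto_truncated_mtv _ fun i => ?_
    have := (mem_filter.1 hj).2 i
    omega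
  refine h.congr fun N => ?_
  rw [← sum_strictAnti_eq_sum_powersetCard fun m : ℕ => geomTail (1 / (2 * (m : ℝ) + 1) ^ 2),
    map_sum, sum_comm]
  refine sum_congr rfl fun f _ => ?_
  rw [coeff_prod_geomTail]
  refine sum_congr rfl fun j _ => prod_congr rfl fun i _ => ?_
  rw [div_pow, one_pow, ← pow_mul]

/-- The recurrence `∑ T(2p, d) (-1)^q e_q = (-1)^{n+d} C(n, d) e_n`, where `e_q = t({2}^q)`. -/
lemma sum_antidiagonal_Tsum_mul (n d : ℕ) :
    ∑ p ∈ antidiagonal n, Tsum p.1 d * ((-1) ^ p.2 * mtv p.2 fun _ => 2) =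
      (-1) ^ (n + d) * (n.choose d : ℝ) * mtv n fun _ => 2 := by
  refine tendsto_nhds_unique (tendsto_finsetSum _ fun p _ =>
    (tendsto_coeff_Tsum p.1 d).mul ((tendsto_oddESymm_mtv p.2).const_mul _))
    (((tendsto_oddESymm_mtv n).const_mul _).congr fun N => ?_)
  have hprod (q : ℕ) : PowerSeries.coeff q (∏ m ∈ range N,
      (1 - PowerSeries.C (1 / (2 * (m : ℝ) + 1) ^ 2) * PowerSeries.X)) =
      (-1) ^ q * oddESymm q N := by
    have h := coeff_sum_signed_powerset (fun m : ℕ => 1 / (2 * (m : ℝ) + 1) ^ 2) 0 q (range N)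
    rw [← sum_powersetCard_mul_prod_one_sub _ _ fun m => one_sub_mul_geomTail _] at h
    simpa [oddESymm] using h
  rw [oddESymm, ← coeff_sum_signed_powerset,
    ← sum_powersetCard_mul_prod_one_sub _ _ fun m => one_sub_mul_geomTail _,
    PowerSeries.coeff_mul]
  simp_rw [hprod]

/-- The Euler numbers are, up to normalization, the coefficients of `1 / cos (π x / 2)`. -/
lemma mk_mtv_two_mul_mk_eulerE :
    PowerSeries.mk (fun k => (-1) ^ k * mtv k fun _ => 2) *
      PowerSeries.mk (fun l => (-1) ^ l * ((Real.pi / 2) ^ (2 * l) / (2 * l).factorial *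
        (eulerE l : ℝ))) = 1 := by
  have hrec (n : ℕ) : ∑ l ∈ range (n + 1), ((2 * n).choose (2 * l) : ℤ) * eulerE l =
      if n = 0 then 1 else 0 := by
    rcases n with _ | n
    · simp [eulerE]
    · rw [sum_range_succ, eulerE, ← Fin.sum_univ_eq_sum_range
        fun l => ((2 * (n + 1)).choose (2 * l) : ℤ) * eulerE l]
      simp
  ext n
  have hrec' : ∑ l ∈ range (n + 1), ((2 * n).choose (2 * l) : ℝ) * (eulerE l : ℝ) =
      if n = 0 then 1 else 0 := by exact_mod_cast hrec n
  rw [mul_comm, PowerSeries.coeff_mul, Finset.Nat.sum_antidiagonal_eq_sum_range_succ_mk,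
    PowerSeries.coeff_one]
  have hterm : ∀ l ∈ range (n + 1),
      ((-1) ^ l * ((Real.pi / 2) ^ (2 * l) / (2 * l).factorial * (eulerE l : ℝ))) *
        ((-1) ^ (n - l) * mtv (n - l) fun _ => 2) =
      ((-1) ^ n * (Real.pi / 2) ^ (2 * n) / (2 * n).factorial) *
        (((2 * n).choose (2 * l) : ℝ) * (eulerE l : ℝ)) := by
    intro l hl
    have hln : l ≤ n := Nat.lt_succ_iff.1 (mem_range.1 hl)
    obtain ⟨k, rfl⟩ := Nat.exists_eq_add_of_le hln
    rw [mtv_two, Nat.add_sub_cancel_left, mul_add 2 l k, Nat.cast_add_choose]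
    have h1 : ((2 * l).factorial : ℝ) ≠ 0 := by positivity
    have h2 : ((2 * k).factorial : ℝ) ≠ 0 := by positivity
    have h3 : ((2 * l + 2 * k).factorial : ℝ) ≠ 0 := by positivity
    field_simp
    ring
  simp only [PowerSeries.coeff_mk]
  rw [sum_congr rfl hterm, ← mul_sum, hrec']
  split_ifs with h
  · simp [h]
  · simp

end MultipleTValue

open MultipleTValue in
/-- Closed formula for `T(2n, d)` in terms of Euler numbers (Theorem 1.3). -/
theorem T2n_d_euler_formula (n d : ℕ) (hd : 1 ≤ d) (hdn : d ≤ n) :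
    Tsum n d = ((-1) ^ (n - d) * Real.pi ^ (2 * n) / (4 ^ n * (2 * n).factorial)) *
      ∑ l ∈ Finset.range (n - d + 1),
        ((n - l).choose d : ℝ) * ((2 * n).choose (2 * l)) * (eulerE l : ℝ) := by
  have hT : PowerSeries.mk (fun m => Tsum m d) *
      PowerSeries.mk (fun k => (-1) ^ k * mtv k fun _ => 2) =
      PowerSeries.mk fun m => (-1) ^ (m + d) * (m.choose d : ℝ) * mtv m fun _ => 2 := by
    ext m
    simp [PowerSeries.coeff_mul, sum_antidiagonal_Tsum_mul]
  have hcoeff := congrArg (fun p => PowerSeries.coeff n (p * PowerSeries.mk (fun l =>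
    (-1) ^ l * ((Real.pi / 2) ^ (2 * l) / (2 * l).factorial * (eulerE l : ℝ))))) hT
  rw [mul_assoc, mk_mtv_two_mul_mk_eulerE, mul_one, PowerSeries.coeff_mk] at hcoeff
  rw [hcoeff, mul_comm, PowerSeries.coeff_mul, Finset.Nat.sum_antidiagonal_eq_sum_range_succ_mk,
    mul_sum]
  symm
  refine sum_subset_zero_on_sdiff (range_subset_range.2 (by omega)) ?_ ?_
  · intro l hl
    rw [Finset.mem_sdiff, mem_range, mem_range] at hl
    simp [Nat.choose_eq_zero_of_lt (show n - l < d by omega)]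
  · intro l hl
    have hln : l ≤ n - d := Nat.lt_succ_iff.1 (mem_range.1 hl)
    obtain ⟨c, rfl⟩ := Nat.exists_eq_add_of_le hdn
    rw [Nat.add_sub_cancel_left] at hln ⊢
    obtain ⟨b, rfl⟩ := Nat.exists_eq_add_of_le hln
    simp only [PowerSeries.coeff_mk]
    rw [mtv_two, show d + (l + b) - l = d + b by omega,
      show 2 * (d + (l + b)) = 2 * l + 2 * (d + b) by ring,
      Nat.cast_add_choose ℝ (a := 2 * l)]
    have h1 : ((2 * l).factorial : ℝ) ≠ 0 := by positivity
    have h2 : ((2 * (d + b)).factorial : ℝ) ≠ 0 := by positivity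
    have h3 : ((2 * l + 2 * (d + b)).factorial : ℝ) ≠ 0 := by positivity
    have h4 : (-1 : ℝ) ^ (d + b + d) = (-1) ^ b := by
      rw [show d + b + d = b + 2 * d by ring, pow_add, pow_mul]; simp
    have h5 : (4 : ℝ) ^ (d + (l + b)) = 2 ^ (2 * l) * 2 ^ (2 * (d + b)) := by
      rw [← pow_add, show 2 * l + 2 * (d + b) = 2 * (d + (l + b)) by ring, pow_mul]; norm_num
    rw [h4, h5, div_pow, div_pow, pow_add, pow_add]
    field_simp
end

section
/- For every positive integer n, the multiple t-value with n arguments all equal to 2 satisfies t(2,2,...,2) = π^{2n} / (4^n (2n)!), i.e. Σ_{n_1 > n_2 > ... > n_n ≥ 1} ∏_{i=1}^{n} 1/(2n_i - 1)^2 = π^{2n} / (4^n (2n)!). -/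
open scoped BigOperators

open Filter Topology

/-- Sending a strictly decreasing tuple to its set of values is a bijection onto the finite sets of
the corresponding cardinality. -/
lemma strictAnti_image_bijective (d : ℕ) :
    Function.Bijective (fun f : {f : Fin d → ℕ // StrictAnti f} =>
      (⟨Finset.univ.image f.1, by
        rw [Finset.card_image_of_injective _ f.2.injective, Finset.card_univ, Fintype.card_fin]⟩ :
        {s : Finset ℕ // s.card = d})) := by
  constructor
  · rintro ⟨f, hf⟩ ⟨g, hg⟩ h
    have h1 : Finset.univ.image f = Finset.univ.image g := congrArg Subtype.val h
    have h2 : Set.range f = Set.range g := by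
      simpa using congrArg (fun s : Finset ℕ => (s : Set ℕ)) h1
    have h3 : f ∘ Fin.rev = g ∘ Fin.rev := by
      refine (StrictMono.range_inj (hf.comp Fin.rev_strictAnti) (hg.comp Fin.rev_strictAnti)).1 ?_
      rw [Fin.rev_surjective.range_comp, Fin.rev_surjective.range_comp, h2]
    exact Subtype.ext (Fin.rev_surjective.injective_comp_right h3)
  · rintro ⟨s, hs⟩
    refine ⟨⟨s.orderEmbOfFin hs ∘ Fin.rev,
      (s.orderEmbOfFin hs).strictMono.comp_strictAnti Fin.rev_strictAnti⟩, ?_⟩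
    apply Subtype.ext
    apply Finset.coe_injective
    rw [Finset.coe_image, Finset.coe_univ, Set.image_univ, Fin.rev_surjective.range_comp,
      Finset.range_orderEmbOfFin]

lemma tsum_strictAnti_prod (d : ℕ) (a : ℕ → ℝ) :
    ∑' f : {f : Fin d → ℕ // StrictAnti f}, ∏ i, a (f.1 i) =
      ∑' s : {s : Finset ℕ // s.card = d}, ∏ i ∈ s.1, a i := by
  rw [← (Equiv.ofBijective _ (strictAnti_image_bijective d)).tsum_eq]
  refine tsum_congr fun f => ?_
  simp [Finset.prod_image f.2.injective.injOn]

/-- The infinite product `∏ (1 + w a_i)` is the generating function of the elementary symmetric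
functions of the `a_i`. -/
lemma hasSum_pow_mul_tsum_card {a : ℕ → ℝ} (ha : Summable a) (w : ℝ) {P : ℝ}
    (hP : Tendsto (fun N => ∏ i ∈ Finset.range N, (1 + w * a i)) atTop (𝓝 P)) :
    HasSum (fun d => w ^ d * ∑' s : {s : Finset ℕ // s.card = d}, ∏ i ∈ s.1, a i) P := by
  have hs : Summable fun s : Finset ℕ => ∏ i ∈ s, w * a i :=
    summable_finsetProd_of_summable_norm (ha.mul_left w).norm
  have hP' := tendsto_nhds_unique hP (hasProd_one_add_of_hasSum_prod hs.hasSum).tendsto_prod_nat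
  have h1 := (Equiv.sigmaFiberEquiv (Finset.card : Finset ℕ → ℕ)).hasSum_iff.2 hs.hasSum
  rw [← hP'] at h1
  have h2 := h1.sigma (fun d => (h1.summable.sigma_factor d).hasSum)
  convert h2 using 2 with d
  rw [← tsum_mul_left]
  refine tsum_congr fun s => ?_
  simp [Equiv.sigmaFiberEquiv, Finset.prod_mul_distrib, s.2]

/-- Euler's product for the cosine. -/
lemma tendsto_euler_cos_prod {z : ℝ} (hz : Real.sin (Real.pi * (z / 2)) ≠ 0) :
    Tendsto (fun N => ∏ i ∈ Finset.range N, (1 + -z ^ 2 * (1 / (2 * (i : ℝ) + 1) ^ 2))) atTop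
      (𝓝 (Real.cos (Real.pi * (z / 2)))) := by
  have h1 := (Real.tendsto_euler_sin_prod z).comp (tendsto_id.const_mul_atTop' two_pos)
  have h2 := Real.tendsto_euler_sin_prod (z / 2)
  have key : ∀ N : ℕ, Real.pi * z * ∏ j ∈ Finset.range (2 * N), (1 - z ^ 2 / ((j : ℝ) + 1) ^ 2) =
      2 * (∏ i ∈ Finset.range N, (1 + -z ^ 2 * (1 / (2 * (i : ℝ) + 1) ^ 2))) *
        (Real.pi * (z / 2) *
          ∏ j ∈ Finset.range N, (1 - (z / 2) ^ 2 / ((j : ℝ) + 1) ^ 2)) := by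
    intro N
    induction N with
    | zero => simp; ring
    | succ N ih =>
      rw [Nat.mul_succ, Finset.prod_range_succ, Finset.prod_range_succ, ← mul_assoc, ← mul_assoc,
        ih, Finset.prod_range_succ, Finset.prod_range_succ]
      have e1 : 1 - z ^ 2 / (((2 * N : ℕ) : ℝ) + 1) ^ 2 =
          1 + -z ^ 2 * (1 / (2 * (N : ℝ) + 1) ^ 2) := by push_cast; ring
      have e2 : 1 - z ^ 2 / (((2 * N + 1 : ℕ) : ℝ) + 1) ^ 2 =
          1 - (z / 2) ^ 2 / ((N : ℝ) + 1) ^ 2 := by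
        have : (N : ℝ) + 1 ≠ 0 := by positivity
        have h : (((2 * N + 1 : ℕ) : ℝ) + 1) = 2 * ((N : ℝ) + 1) := by push_cast; ring
        rw [h]
        field_simp
      rw [e1, e2]
      ring
  have h3 : Real.sin (Real.pi * z) / (2 * Real.sin (Real.pi * (z / 2))) =
      Real.cos (Real.pi * (z / 2)) := by
    rw [show Real.pi * z = 2 * (Real.pi * (z / 2)) by ring, Real.sin_two_mul]
    exact mul_div_cancel_left₀ _ (mul_ne_zero two_ne_zero hz)
  rw [← h3]
  refine (h1.div (h2.const_mul 2) (mul_ne_zero two_ne_zero hz)).congr' ?_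
  filter_upwards [h2.eventually_ne hz] with N hN
  simp only [Function.comp_apply, id, Pi.div_apply]
  rw [key, mul_comm (2 : ℝ), mul_assoc, mul_div_assoc, div_self (mul_ne_zero two_ne_zero hN),
    mul_one]

/-- Two everywhere convergent power series agreeing frequently near `0` have the same
coefficients. -/
lemma coeff_eq_of_frequently_hasSum {a b : ℕ → ℝ} {f g : ℝ → ℝ}
    (hf : ∀ w, HasSum (fun n => w ^ n * a n) (f w))
    (hg : ∀ w, HasSum (fun n => w ^ n * b n) (g w))
    (hfg : ∃ᶠ w in 𝓝[≠] 0, f w = g w) : a = b := by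
  have hasF : ∀ {c : ℕ → ℝ} {h : ℝ → ℝ}, (∀ w, HasSum (fun n => w ^ n * c n) (h w)) →
      HasFPowerSeriesAt h (FormalMultilinearSeries.ofScalars ℝ c) 0 := by
    intro c h hh
    rw [hasFPowerSeriesAt_iff]
    exact Eventually.of_forall fun z => by
      simpa [FormalMultilinearSeries.coeff_ofScalars] using hh z
  have h1 := hasF hf
  have h2 := hasF hg
  have h3 := (h1.analyticAt.frequently_eq_iff_eventually_eq h2.analyticAt).1 hfg
  have h4 := h1.eq_formalMultilinearSeries_of_eventually h2 h3
  funext n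
  simpa [FormalMultilinearSeries.coeff_ofScalars] using
    congrArg (fun p : FormalMultilinearSeries ℝ ℝ ℝ => p.coeff n) h4

lemma summable_one_div_odd_sq : Summable fun i : ℕ => 1 / (2 * (i : ℝ) + 1) ^ 2 := by
  have h := (Real.summable_one_div_nat_pow.2 one_lt_two).comp_injective
    (show Function.Injective fun i : ℕ => 2 * i + 1 from fun i j h => by simpa using h)
  simpa [Function.comp_def] using h

/-- Lemma 2.1: `t({2}^n) = π^{2n} / (4^n (2n)!)`. -/
theorem t_two_repeated (n : ℕ) (hn : 1 ≤ n) :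
    mtv n (fun _ => 2) = Real.pi ^ (2 * n) / (4 ^ n * (2 * n).factorial) := by
  have ha := summable_one_div_odd_sq
  have hf : ∀ w : ℝ, HasSum (fun d => w ^ d * mtv d (fun _ => 2))
      (∑' s : Finset ℕ, ∏ i ∈ s, w * (1 / (2 * (i : ℝ) + 1) ^ 2)) := by
    intro w
    have hs := summable_finsetProd_of_summable_norm (ha.mul_left w).norm
    have := hasSum_pow_mul_tsum_card ha w (hasProd_one_add_of_hasSum_prod hs.hasSum).tendsto_prod_nat
    simpa only [mtv, tsum_strictAnti_prod _ fun i : ℕ => 1 / (2 * (i : ℝ) + 1) ^ 2] using this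
  have hc : ∀ w : ℝ, Summable fun d : ℕ =>
      w ^ d * (Real.pi ^ (2 * d) / (4 ^ d * (2 * d).factorial)) := by
    intro w
    have h := (Real.summable_pow_div_factorial (Real.pi / 2 * √|w|)).comp_injective
      (mul_right_injective₀ (two_ne_zero' ℕ))
    refine Summable.of_norm (h.congr fun d => ?_)
    simp only [Function.comp_apply, norm_mul, norm_div, norm_pow, Real.norm_eq_abs]
    rw [mul_pow, pow_mul (√|w|), Real.sq_sqrt (abs_nonneg w), div_pow, pow_mul 2 2,
      abs_of_pos Real.pi_pos, Nat.abs_cast]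
    norm_num
    field_simp
  refine congrFun (coeff_eq_of_frequently_hasSum hf (fun w => (hc w).hasSum) ?_) n
  have hagree : ∀ z : ℝ, 0 < z → z < 1 →
      ∑' s : Finset ℕ, ∏ i ∈ s, -z ^ 2 * (1 / (2 * (i : ℝ) + 1) ^ 2) =
        ∑' d : ℕ, (-z ^ 2) ^ d * (Real.pi ^ (2 * d) / (4 ^ d * (2 * d).factorial)) := by
    intro z h0 h1
    have hsin : Real.sin (Real.pi * (z / 2)) ≠ 0 :=
      (Real.sin_pos_of_pos_of_lt_pi (by positivity) (by nlinarith [Real.pi_pos])).ne'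
    have hs := summable_finsetProd_of_summable_norm (ha.mul_left (-z ^ 2)).norm
    rw [tendsto_nhds_unique (hasProd_one_add_of_hasSum_prod hs.hasSum).tendsto_prod_nat
      (tendsto_euler_cos_prod hsin), Real.cos_eq_tsum]
    refine tsum_congr fun d => ?_
    rw [neg_pow (z ^ 2), ← pow_mul, mul_pow, div_pow, pow_mul 2 2]
    norm_num
    field_simp
  have hlim : Tendsto (fun z : ℝ => -z ^ 2) (𝓝[>] 0) (𝓝[≠] 0) := by
    refine tendsto_nhdsWithin_iff.2 ⟨?_, ?_⟩
    · have : Continuous fun z : ℝ => -z ^ 2 := by fun_prop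
      simpa using (this.tendsto 0).mono_left nhdsWithin_le_nhds
    · filter_upwards [self_mem_nhdsWithin] with z hz
      simpa using (ne_of_gt hz : z ≠ 0)
  refine hlim.frequently (Eventually.frequently ?_)
  filter_upwards [Ioo_mem_nhdsGT (zero_lt_one' ℝ)] with z hz using hagree z hz.1 hz.2
end

section
/- For every real number x ≥ 0, the infinite product over the odd squares satisfies ∏_{j=1}^{∞} (1 + x/(2j-1)^2) = cosh(π√x / 2). -/
open scoped BigOperators

/-- Euler's product for the hyperbolic sine. -/
theorem Real.tendsto_euler_sinh_prod (t : ℝ) :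
    Filter.Tendsto
      (fun n : ℕ => Real.pi * t * ∏ j ∈ Finset.range n, (1 + t ^ 2 / ((j : ℝ) + 1) ^ 2))
      Filter.atTop (nhds (Real.sinh (Real.pi * t))) := by
  have h := (Complex.tendsto_euler_sin_prod (t * Complex.I)).mul_const (-Complex.I)
  rw [← mul_assoc, Complex.sin_mul_I] at h
  have hI : ∀ a : ℂ, a * Complex.I * -Complex.I = a := fun a => by
    rw [mul_assoc, mul_neg, Complex.I_mul_I, neg_neg, mul_one]
  rw [hI] at h
  have h' := (Complex.continuous_re.tendsto _).comp h
  rw [← Complex.ofReal_mul, Complex.sinh_ofReal_re] at h'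
  refine h'.congr fun n => ?_
  have key : ((Real.pi * t : ℝ) : ℂ) * Complex.I *
      (∏ j ∈ Finset.range n, (1 - ((t : ℂ) * Complex.I) ^ 2 / ((j : ℂ) + 1) ^ 2)) * -Complex.I =
      ((Real.pi * t * ∏ j ∈ Finset.range n, (1 + t ^ 2 / ((j : ℝ) + 1) ^ 2) : ℝ) : ℂ) := by
    rw [← hI ((Real.pi * t * ∏ j ∈ Finset.range n, (1 + t ^ 2 / ((j : ℝ) + 1) ^ 2) : ℝ) : ℂ)]
    push_cast
    simp only [mul_pow, Complex.I_sq, mul_neg, mul_one, neg_div, sub_neg_eq_add]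
    ring
  simp only [Function.comp_apply]
  rw [key, Complex.ofReal_re]

theorem prod_range_two_mul_one_add_div_sq (t : ℝ) (n : ℕ) :
    ∏ j ∈ Finset.range (2 * n), (1 + t ^ 2 / ((j : ℝ) + 1) ^ 2) =
      (∏ j ∈ Finset.range n, (1 + t ^ 2 / (2 * (j : ℝ) + 1) ^ 2)) *
        ∏ j ∈ Finset.range n, (1 + (t / 2) ^ 2 / ((j : ℝ) + 1) ^ 2) := by
  induction n with
  | zero => simp
  | succ n ih =>
    rw [show 2 * (n + 1) = 2 * n + 1 + 1 by ring, Finset.prod_range_succ, Finset.prod_range_succ,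
      ih, Finset.prod_range_succ, Finset.prod_range_succ]
    have h : t ^ 2 / (((2 * n + 1 : ℕ) : ℝ) + 1) ^ 2 = (t / 2) ^ 2 / ((n : ℝ) + 1) ^ 2 := by
      rw [← div_pow, ← div_pow, div_div]
      push_cast
      ring_nf
    rw [h]
    push_cast
    ring

theorem summable_div_odd_sq (x : ℝ) : Summable fun j : ℕ => x / (2 * (j : ℝ) + 1) ^ 2 := by
  have h : Summable fun n : ℕ => 1 / (n : ℝ) ^ 2 :=
    Real.summable_one_div_nat_pow.mpr one_lt_two
  have h' := (h.comp_injective (i := fun j : ℕ => 2 * j + 1)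
    (fun a b hab => by simpa using hab)).mul_left x
  refine h'.congr fun j => ?_
  simp [div_eq_mul_inv]

/-- The infinite product over the odd squares:
`∏_{j ≥ 1} (1 + x/(2j-1)^2) = cosh(π√x / 2)` (the factor for `j ≥ 1` is indexed
here by `j - 1 : ℕ`, so `2j - 1` becomes `2j + 1`). -/
theorem prod_one_add_div_odd_sq (x : ℝ) (hx : 0 ≤ x) :
    ∏' j : ℕ, (1 + x / (2 * (j : ℝ) + 1) ^ 2) = Real.cosh (Real.pi * Real.sqrt x / 2) := by
  rcases hx.eq_or_lt with rfl | hpos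
  · simp
  have hprod := (Real.multipliable_one_add_of_summable
    (summable_div_odd_sq x)).hasProd.tendsto_prod_nat
  refine tendsto_nhds_unique hprod ?_
  obtain ⟨t, ht, rfl⟩ : ∃ t : ℝ, 0 < t ∧ t ^ 2 = x :=
    ⟨√x, Real.sqrt_pos.mpr hpos, Real.sq_sqrt hx⟩
  rw [Real.sqrt_sq ht.le]
  have hs : 0 < Real.sinh (Real.pi * (t / 2)) := Real.sinh_pos_iff.mpr (by positivity)
  have hdouble : Filter.Tendsto (fun n : ℕ => 2 * n) Filter.atTop Filter.atTop :=
    Filter.tendsto_id.const_mul_atTop' two_pos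
  have hlim := (((Real.tendsto_euler_sinh_prod t).comp hdouble).div
    (Real.tendsto_euler_sinh_prod (t / 2)) hs.ne').div_const 2
  have hval : Real.sinh (Real.pi * t) / Real.sinh (Real.pi * (t / 2)) / 2 =
      Real.cosh (Real.pi * t / 2) := by
    rw [show Real.pi * t = 2 * (Real.pi * (t / 2)) by ring, Real.sinh_two_mul,
      show 2 * (Real.pi * (t / 2)) / 2 = Real.pi * (t / 2) by ring]
    field_simp
  rw [hval] at hlim
  refine hlim.congr fun n => ?_
  have hA : 0 < ∏ j ∈ Finset.range n, (1 + (t / 2) ^ 2 / ((j : ℝ) + 1) ^ 2) :=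
    Finset.prod_pos fun j _ => by positivity
  simp only [Pi.div_apply, Function.comp_apply]
  rw [prod_range_two_mul_one_add_div_sq]
  generalize ∏ j ∈ Finset.range n, (1 + (t / 2) ^ 2 / ((j : ℝ) + 1) ^ 2) = A at hA ⊢
  have := Real.pi_pos
  field_simp
end

section
/- For all integers n and d with 1 ≤ d ≤ n, the following identity between Bernoulli and Euler numbers holds: Σ_{j=0}^{⌊(d-1)/2⌋} ((2^{2n-2j} - 1) B_{2n-2j} / (2^{2d-1} d)) · C(2d-2j-2, d-1) · C(2n, 2j) = ((-1)^{d+1} / 4^n) · Σ_{ℓ=0}^{n-d} C(n-ℓ, d) · C(2n, 2ℓ) · E_{2ℓ}, where C(a,b) denotes the binomial coefficient. -/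
open scoped BigOperators

open PowerSeries in
/-- The exponential generating function of the Euler numbers, that is, `1 / cosh`. -/
noncomputable def eulerPowerSeries : ℚ⟦X⟧ :=
  mk fun k => if Even k then (eulerE (k / 2) : ℚ) / k.factorial else 0

theorem sum_choose_mul_eulerE (n : ℕ) :
    ∑ l ∈ Finset.range (n + 1), ((2 * n).choose (2 * l) : ℚ) * eulerE l =
      if n = 0 then 1 else 0 := by
  cases n with
  | zero => simp [eulerE]
  | succ n =>
    rw [Finset.sum_range_succ]
    conv_lhs => rw [eulerE]
    rw [Fin.sum_univ_eq_sum_range (fun k => ((2 * (n + 1)).choose (2 * k) : ℤ) * eulerE k)]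
    simp

theorem sum_range_two_mul_succ_of_odd_eq_zero {M : Type*} [AddCommMonoid M] (f : ℕ → M)
    (hf : ∀ k, f (2 * k + 1) = 0) (n : ℕ) :
    ∑ k ∈ Finset.range (2 * n + 1), f k = ∑ l ∈ Finset.range (n + 1), f (2 * l) := by
  induction n with
  | zero => simp
  | succ n ih =>
    rw [show 2 * (n + 1) + 1 = 2 * n + 1 + 1 + 1 by ring, Finset.sum_range_succ,
      Finset.sum_range_succ, ih, hf, add_zero, Finset.sum_range_succ _ (n + 1)]
    rfl

section PowerSeries

open PowerSeries

theorem coeff_eulerPowerSeries_mul (f : ℚ⟦X⟧) (n : ℕ) :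
    coeff (2 * n) (eulerPowerSeries * f) =
      ∑ l ∈ Finset.range (n + 1),
        (eulerE l : ℚ) / (2 * l).factorial * coeff (2 * (n - l)) f := by
  rw [coeff_mul, Finset.Nat.sum_antidiagonal_eq_sum_range_succ_mk,
    sum_range_two_mul_succ_of_odd_eq_zero _ (fun k => by simp [eulerPowerSeries])]
  exact Finset.sum_congr rfl fun l _ => by simp [eulerPowerSeries, Nat.mul_sub]

theorem coeff_exp_add_evalNegHom_exp (k : ℕ) :
    coeff k (exp ℚ + evalNegHom (exp ℚ)) = if Even k then 2 / (k.factorial : ℚ) else 0 := by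
  rw [map_add, evalNegHom, coeff_rescale, coeff_exp]
  rcases Nat.even_or_odd k with h | h
  · simp [h, h.neg_one_pow]; ring
  · simp [h.neg_one_pow, Nat.not_even_iff_odd.2 h]

theorem eulerPowerSeries_mul_exp_add : eulerPowerSeries * (exp ℚ + evalNegHom (exp ℚ)) = 2 := by
  ext k
  rw [show (2 : ℚ⟦X⟧) = C 2 from rfl, coeff_C]
  rcases Nat.even_or_odd' k with ⟨n, rfl | rfl⟩
  · rw [coeff_eulerPowerSeries_mul]
    have h := congrArg (fun q : ℚ => 2 / ((2 * n).factorial : ℚ) * q) (sum_choose_mul_eulerE n)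
    simp only [Finset.mul_sum] at h
    trans (2 / ((2 * n).factorial : ℚ) * if n = 0 then 1 else 0)
    · rw [← h]
      refine Finset.sum_congr rfl fun l hl => ?_
      have hl' : l ≤ n := by simpa [Nat.lt_succ_iff] using hl
      rw [coeff_exp_add_evalNegHom_exp, if_pos (even_two_mul _),
        Nat.cast_choose ℚ (by omega : 2 * l ≤ 2 * n), ← Nat.mul_sub]
      field_simp
    · rcases eq_or_ne n 0 with rfl | hn
      · simp
      · simp [hn]
  · rw [if_neg (by omega), coeff_mul]
    refine Finset.sum_eq_zero fun p hp => ?_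
    rw [Finset.HasAntidiagonal.mem_antidiagonal] at hp
    rw [coeff_exp_add_evalNegHom_exp, eulerPowerSeries, coeff_mk]
    split_ifs with h₁ h₂
    · have := h₁.add h₂
      rw [hp] at this
      exact absurd this (by simp)
    all_goals simp

theorem exp_sq_eq_rescale : exp ℚ ^ 2 = rescale 2 (exp ℚ) := by
  exact_mod_cast exp_pow_eq_rescale_exp (A := ℚ) 2

theorem exp_pow_four_eq_rescale : exp ℚ ^ 4 = rescale 4 (exp ℚ) := by
  exact_mod_cast exp_pow_eq_rescale_exp (A := ℚ) 4

theorem exp_sq_sub_one_ne_zero : exp ℚ ^ 2 - 1 ≠ 0 := by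
  intro h
  have := congrArg (coeff 1) h
  rw [exp_sq_eq_rescale] at this
  simp [coeff_rescale, coeff_exp, coeff_one] at this

/-- A form of the expansion `x * (tanh x - 1) = ∑ (4^k - 2^k) B_k x^k / k!`. -/
theorem rescale_bernoulliPowerSeries_sub_mul :
    (rescale 4 (bernoulliPowerSeries ℚ) - rescale 2 (bernoulliPowerSeries ℚ)) * (exp ℚ ^ 2 + 1) =
      -2 * X := by
  have h₂ := congrArg (rescale (2 : ℚ)) (bernoulliPowerSeries_mul_exp_sub_one ℚ)
  have h₄ := congrArg (rescale (4 : ℚ)) (bernoulliPowerSeries_mul_exp_sub_one ℚ)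
  rw [map_mul, map_sub, map_one, rescale_X, ← exp_sq_eq_rescale,
    show (C (2 : ℚ) : ℚ⟦X⟧) = 2 from rfl] at h₂
  rw [map_mul, map_sub, map_one, rescale_X, ← exp_pow_four_eq_rescale,
    show (C (4 : ℚ) : ℚ⟦X⟧) = 4 from rfl] at h₄
  refine mul_right_cancel₀ exp_sq_sub_one_ne_zero ?_
  linear_combination h₄ - (exp ℚ ^ 2 + 1) * h₂

theorem eulerPowerSeries_mul_X_mul_exp_sub :
    eulerPowerSeries * (X * (exp ℚ - evalNegHom (exp ℚ))) =
      2 * (X + (rescale 4 (bernoulliPowerSeries ℚ) - rescale 2 (bernoulliPowerSeries ℚ))) := by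
  have hne : exp ℚ ^ 2 + 1 ≠ 0 := by
    intro h
    have := congrArg (constantCoeff (R := ℚ)) h
    norm_num at this
  refine mul_right_cancel₀ hne ?_
  have h₁ := exp_mul_exp_neg_eq_one (A := ℚ)
  have h₂ := eulerPowerSeries_mul_exp_add
  have h₃ := rescale_bernoulliPowerSeries_sub_mul
  have h₄ : eulerPowerSeries * (exp ℚ ^ 2 + 1) = 2 * exp ℚ := by
    linear_combination exp ℚ * h₂ - eulerPowerSeries * h₁
  linear_combination X * (exp ℚ - evalNegHom (exp ℚ)) * h₄ - 2 * X * h₁ - 2 * h₃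

theorem coeff_X_mul_exp_sub (m : ℕ) :
    coeff (2 * m) (X * (exp ℚ - evalNegHom (exp ℚ))) = 4 * m / ((2 * m).factorial : ℚ) := by
  cases m with
  | zero => simp
  | succ m =>
    rw [show 2 * (m + 1) = 2 * m + 1 + 1 by ring, coeff_succ_X_mul, map_sub, evalNegHom,
      coeff_rescale, coeff_exp, Odd.neg_one_pow (by simp), Nat.factorial_succ (2 * m + 1)]
    simp
    field_simp
    ring

end PowerSeries

theorem sum_sub_mul_choose_mul_eulerE (n : ℕ) :
    2 * ∑ l ∈ Finset.range (n + 1), ((n - l : ℕ) : ℚ) * (2 * n).choose (2 * l) * eulerE l =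
      4 ^ n * ((4 ^ n - 1) * bernoulli (2 * n)) := by
  have h := congrArg (PowerSeries.coeff (2 * n)) eulerPowerSeries_mul_X_mul_exp_sub
  rw [coeff_eulerPowerSeries_mul, show (2 : PowerSeries ℚ) = PowerSeries.C 2 from rfl,
    PowerSeries.coeff_C_mul, map_add, map_sub, PowerSeries.coeff_X, if_neg (by omega),
    PowerSeries.coeff_rescale, PowerSeries.coeff_rescale, bernoulliPowerSeries,
    PowerSeries.coeff_mk] at h
  have hf : ((2 * n).factorial : ℚ) ≠ 0 := by positivity
  have h' := congrArg (fun q : ℚ => (2 * n).factorial / 2 * q) h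
  simp only [Finset.mul_sum] at h'
  rw [Finset.mul_sum]
  trans ((2 * n).factorial / 2 * (2 * (0 + (4 ^ (2 * n) * (bernoulli (2 * n) / (2 * n).factorial)
      - 2 ^ (2 * n) * (bernoulli (2 * n) / (2 * n).factorial)))) : ℚ)
  · simp only [eq_ratCast, Rat.cast_id] at h'
    rw [← h']
    refine Finset.sum_congr rfl fun l hl => ?_
    have hl' : l ≤ n := by simpa [Nat.lt_succ_iff] using hl
    rw [coeff_X_mul_exp_sub, Nat.cast_choose ℚ (by omega : 2 * l ≤ 2 * n), ← Nat.mul_sub]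
    field_simp
    ring
  · rw [pow_mul 2 2 n, mul_comm 2 n, pow_mul]
    field_simp
    norm_num [← mul_pow]
    ring

theorem cast_choose_succ_mul_succ (n k : ℕ) :
    (n.choose (k + 1) : ℚ) * (k + 1) = n.choose k * (n - k) := by
  rcases le_or_gt k n with h | h
  · have := Nat.choose_succ_right_eq n k
    rw [← Nat.cast_sub h]
    exact_mod_cast this
  · simp [Nat.choose_eq_zero_of_lt h, Nat.choose_eq_zero_of_lt (h.trans (Nat.lt_succ_self k))]

theorem cast_choose_succ_succ_mul_succ (n k : ℕ) :
    ((n + 1).choose (k + 1) : ℚ) * (k + 1) = (n + 1) * n.choose k := by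
  exact_mod_cast (Nat.add_one_mul_choose_eq n k).symm

theorem cast_choose_add_two_mul (n k : ℕ) :
    ((n + 2).choose (k + 2) : ℚ) * ((k + 2) * (k + 1)) = (n + 2) * (n + 1) * n.choose k := by
  have h₁ := cast_choose_succ_succ_mul_succ (n + 1) (k + 1)
  have h₂ := cast_choose_succ_succ_mul_succ n k
  push_cast at h₁
  linear_combination (k + 1 : ℚ) * h₁ + (n + 2 : ℚ) * h₂

/-- The sum `∑ C(n - l, d) C(2n, 2l) E_{2l}`, over all `l ≤ n`. -/
def eulerSum (d n : ℕ) : ℚ :=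
  ∑ l ∈ Finset.range (n + 1), ((n - l).choose d : ℚ) * (2 * n).choose (2 * l) * eulerE l

theorem eulerSum_recurrence (d n : ℕ) :
    4 * (d + 2) * (d + 1) * eulerSum (d + 2) (n + 1)
        + (4 * d + 2) * (d + 1) * eulerSum (d + 1) (n + 1) =
      (2 * n + 2) * (2 * n + 1) * eulerSum d n := by
  simp only [eulerSum]
  rw [Finset.sum_range_succ, Finset.sum_range_succ _ (n + 1)]
  simp only [Nat.sub_self, Nat.choose_zero_succ, Nat.cast_zero, zero_mul, add_zero,
    Finset.mul_sum]
  rw [← Finset.sum_add_distrib]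
  refine Finset.sum_congr rfl fun l hl => ?_
  obtain ⟨m, rfl⟩ : ∃ m, n = l + m :=
    Nat.exists_eq_add_of_le (by simpa [Nat.lt_succ_iff] using hl)
  rw [show l + m + 1 - l = m + 1 by omega, show l + m - l = m by omega,
    show 2 * (l + m + 1) = 2 * (l + m) + 2 by ring]
  have h₁ := cast_choose_add_two_mul (2 * (l + m)) (2 * m)
  rw [Nat.choose_symm_of_eq_add (show 2 * (l + m) + 2 = 2 * m + 2 + 2 * l by ring),
    Nat.choose_symm_of_eq_add (show 2 * (l + m) = 2 * m + 2 * l by ring)] at h₁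
  have h₂ := cast_choose_succ_succ_mul_succ m d
  have h₃ := cast_choose_succ_mul_succ (m + 1) (d + 1)
  push_cast at h₁ h₂ h₃ ⊢
  generalize ((2 * (l + m) + 2).choose (2 * l) : ℚ) = c at *
  linear_combination 4 * (d + 1) * c * eulerE l * h₃ + (4 * m + 2) * c * eulerE l * h₂
    + m.choose d * eulerE l * h₁

/-- The coefficient `C(2k - 2j, k)`, cut off to `2j ≤ k`. -/
def bernoulliSumCoeff (k j : ℕ) : ℚ :=
  if 2 * j ≤ k then ((2 * k - 2 * j).choose k : ℚ) else 0

theorem bernoulliSumCoeff_recurrence (k j : ℕ) :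
    (k + 1) * ((k + 2) * bernoulliSumCoeff (k + 2) (j + 1)
        - (4 * k + 6) * bernoulliSumCoeff (k + 1) (j + 1)) =
      (2 * j + 2) * (2 * j + 1) * bernoulliSumCoeff k j := by
  rcases lt_or_ge k (2 * j) with h | h
  · simp only [bernoulliSumCoeff]
    rw [if_neg (by omega), if_neg (by omega), if_neg (by omega)]
    simp
  · have hmid : bernoulliSumCoeff (k + 1) (j + 1) = ((2 * k - 2 * j).choose (k + 1) : ℚ) := by
      rw [bernoulliSumCoeff]
      split_ifs with h'
      · rw [show 2 * (k + 1) - 2 * (j + 1) = 2 * k - 2 * j by omega]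
      · rw [Nat.choose_eq_zero_of_lt (by omega), Nat.cast_zero]
    rw [hmid, bernoulliSumCoeff, bernoulliSumCoeff, if_pos (by omega), if_pos h,
      show 2 * (k + 2) - 2 * (j + 1) = 2 * k - 2 * j + 2 by omega]
    have h₁ := cast_choose_add_two_mul (2 * k - 2 * j) k
    have h₂ := cast_choose_succ_mul_succ (2 * k - 2 * j) k
    have h₃ : ((2 * k - 2 * j : ℕ) : ℚ) = 2 * k - 2 * j := by
      rw [Nat.cast_sub (by omega)]
      push_cast
      ring
    rw [h₃] at h₁ h₂
    linear_combination h₁ - (4 * k + 6) * h₂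

theorem bernoulliSumCoeff_zero_recurrence (k : ℕ) :
    (k + 2) * bernoulliSumCoeff (k + 2) 0 = (4 * k + 6) * bernoulliSumCoeff (k + 1) 0 := by
  have h := Nat.succ_mul_centralBinom_succ (k + 1)
  simp only [Nat.centralBinom] at h
  have h' : ((k + 1 + 1 : ℕ) * (2 * (k + 1 + 1)).choose (k + 1 + 1) : ℚ) =
      2 * (2 * (k + 1 : ℕ) + 1) * (2 * (k + 1)).choose (k + 1) := by exact_mod_cast h
  simp only [bernoulliSumCoeff, mul_zero, Nat.zero_le, if_true, Nat.sub_zero]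
  push_cast at h'
  linear_combination h'

/-- The sum `∑ (4^(n-j) - 1) B_{2n-2j} C(2k - 2j, k) C(2n, 2j)` over `2j ≤ k`, `j ≤ n`. -/
def bernoulliSum (k n : ℕ) : ℚ :=
  ∑ j ∈ Finset.range (n + 1),
    (4 ^ (n - j) - 1) * bernoulli (2 * (n - j)) * bernoulliSumCoeff k j * (2 * n).choose (2 * j)

theorem bernoulliSum_recurrence (k n : ℕ) :
    (k + 1) * ((k + 2) * bernoulliSum (k + 2) (n + 1)
        - (4 * k + 6) * bernoulliSum (k + 1) (n + 1)) =
      (2 * n + 2) * (2 * n + 1) * bernoulliSum k n := by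
  simp only [bernoulliSum, Finset.mul_sum]
  rw [← Finset.sum_sub_distrib, Finset.mul_sum, Finset.sum_range_succ']
  have h₀ := bernoulliSumCoeff_zero_recurrence k
  have hzero (b c : ℚ) : (k + 1) * ((k + 2) * (b * bernoulliSumCoeff (k + 2) 0 * c)
      - (4 * k + 6) * (b * bernoulliSumCoeff (k + 1) 0 * c)) = 0 := by
    linear_combination (k + 1) * b * c * h₀
  rw [hzero, add_zero]
  refine Finset.sum_congr rfl fun j _ => ?_
  have h₁ := bernoulliSumCoeff_recurrence k j
  have h₂ := cast_choose_add_two_mul (2 * n) (2 * j)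
  rw [Nat.add_sub_add_right, show 2 * (n + 1) = 2 * n + 2 by ring,
    show 2 * (j + 1) = 2 * j + 2 by ring]
  push_cast at h₂
  linear_combination
    (4 ^ (n - j) - 1) * bernoulli (2 * (n - j)) * (2 * n + 2).choose (2 * j + 2) * h₁
      + (4 ^ (n - j) - 1) * bernoulli (2 * (n - j)) * bernoulliSumCoeff k j * h₂

theorem bernoulliSum_zero (n : ℕ) : bernoulliSum 0 n = (4 ^ n - 1) * bernoulli (2 * n) := by
  rw [bernoulliSum, Finset.sum_range_succ', Finset.sum_eq_zero] <;> simp [bernoulliSumCoeff]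

theorem bernoulliSum_one (n : ℕ) : bernoulliSum 1 n = 2 * ((4 ^ n - 1) * bernoulli (2 * n)) := by
  rw [bernoulliSum, Finset.sum_range_succ', Finset.sum_eq_zero]
  · simp [bernoulliSumCoeff]
    ring
  · intro j _
    simp [bernoulliSumCoeff, show ¬ 2 * (j + 1) ≤ 1 by omega]

theorem four_pow_mul_bernoulliSum (k n : ℕ) (hkn : k + 1 ≤ n) :
    4 ^ n * bernoulliSum k n = (-1) ^ k * (2 * 4 ^ k) * (k + 1) * eulerSum (k + 1) n := by
  have base (n : ℕ) :
      2 * eulerSum 1 n = 4 ^ n * ((4 ^ n - 1) * bernoulli (2 * n)) := by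
    simpa [eulerSum] using sum_sub_mul_choose_mul_eulerE n
  induction k using Nat.twoStepInduction generalizing n with
  | zero =>
    rw [bernoulliSum_zero, ← base n]
    norm_num
  | one =>
    obtain ⟨m, rfl⟩ : ∃ m, n = m + 1 := ⟨n - 1, by omega⟩
    have h := eulerSum_recurrence 0 m
    have h₀ : eulerSum 0 m = 0 := by
      simpa [eulerSum, show m ≠ 0 by omega] using sum_choose_mul_eulerE m
    rw [h₀] at h
    rw [bernoulliSum_one]
    have hb := base (m + 1)
    norm_num at h hb ⊢
    linear_combination -2 * hb + 2 * h
  | more k ih₀ ih₁ =>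
    obtain ⟨m, rfl⟩ : ∃ m, n = m + 1 := ⟨n - 1, by omega⟩
    have i₀ := ih₀ m (by omega)
    have i₁ := ih₁ (m + 1) (by omega)
    have hb := bernoulliSum_recurrence k m
    have he := eulerSum_recurrence (k + 1) m
    have hk : ((k : ℚ) + 1) * (k + 2) ≠ 0 := by positivity
    refine mul_left_cancel₀ hk ?_
    simp only [pow_succ] at i₁ ⊢
    push_cast at i₁ he ⊢
    rw [show k + 1 + 2 = k + 2 + 1 from rfl, show k + 1 + 1 = k + 2 from rfl] at *
    linear_combination 4 ^ m * 4 * hb + (k + 1) * (4 * k + 6) * i₁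
      + 4 * (2 * m + 2) * (2 * m + 1) * i₀ - (-1) ^ k * 4 ^ k * 8 * (k + 1) * he

/-- Identity between Bernoulli and Euler numbers (Theorem 3.1, first identity). -/
theorem bernoulli_euler_identity (n d : ℕ) (hd : 1 ≤ d) (hdn : d ≤ n) :
    ∑ j ∈ Finset.range ((d - 1) / 2 + 1),
        ((2 ^ (2 * n - 2 * j) - 1) * bernoulli (2 * n - 2 * j) / (2 ^ (2 * d - 1) * d)) *
          ((2 * d - 2 * j - 2).choose (d - 1)) * ((2 * n).choose (2 * j))
      = ((-1) ^ (d + 1) / 4 ^ n) *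
          ∑ l ∈ Finset.range (n - d + 1),
            ((n - l).choose d : ℚ) * ((2 * n).choose (2 * l)) * (eulerE l : ℚ) := by
  obtain ⟨k, rfl⟩ : ∃ k, d = k + 1 := ⟨d - 1, by omega⟩
  have hR : ∑ l ∈ Finset.range (n - (k + 1) + 1),
      ((n - l).choose (k + 1) : ℚ) * ((2 * n).choose (2 * l)) * (eulerE l : ℚ) =
        eulerSum (k + 1) n := by
    refine Finset.sum_subset (Finset.range_mono (by omega)) fun l _ hl => ?_
    rw [Finset.mem_range] at hl
    simp [Nat.choose_eq_zero_of_lt (show n - l < k + 1 by omega)]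
  have hL : ∑ j ∈ Finset.range (k / 2 + 1),
      ((2 ^ (2 * n - 2 * j) - 1) * bernoulli (2 * n - 2 * j) / (2 ^ (2 * (k + 1) - 1) * (k + 1))) *
        ((2 * (k + 1) - 2 * j - 2).choose k) * ((2 * n).choose (2 * j)) =
      bernoulliSum k n / (2 * 4 ^ k * (k + 1)) := by
    rw [bernoulliSum, Finset.sum_div]
    trans ∑ j ∈ Finset.range (k / 2 + 1), (4 ^ (n - j) - 1) * bernoulli (2 * (n - j)) *
      bernoulliSumCoeff k j * (2 * n).choose (2 * j) / (2 * 4 ^ k * (k + 1))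
    · refine Finset.sum_congr rfl fun j hj => ?_
      rw [Finset.mem_range] at hj
      rw [bernoulliSumCoeff, if_pos (by omega), show 2 * (k + 1) - 2 * j - 2 = 2 * k - 2 * j by omega,
        ← Nat.mul_sub, pow_mul, show 2 * (k + 1) - 1 = 2 * k + 1 by omega, pow_succ _ (2 * k),
        pow_mul _ 2 k]
      norm_num
      ring
    · refine Finset.sum_subset (Finset.range_mono (by omega)) fun j _ hj => ?_
      rw [Finset.mem_range] at hj
      simp [bernoulliSumCoeff, show ¬ 2 * j ≤ k by omega]
  have h := four_pow_mul_bernoulliSum k n hdn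
  rw [hR, Nat.add_sub_cancel]
  push_cast
  rw [hL]
  field_simp
  rw [pow_add]
  linear_combination h
end
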